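/- There exists a bounded linear operator T on the real Banach space ℓ¹ such that: (1) T is quasinilpotent (spectral radius 0); (2) T has no nontrivial closed invariant subspace; (3) the positive part T⁺ — the bounded operator on ℓ¹ whose matrix entries are max(t_{ij}, 0), where t_{ij} = (T f_j)_i — satisfies r(T⁺) > 0 and has a positive eigenvector for the eigenvalue r(T⁺); (4) the negative part T⁻ (matrix entries max(−t_{ij}, 0)) has a nonzero positive eigenvector (indeed T⁻ f_0 = 0); and (5) neither the modulus |T| (matrix entries |t_{ij}|) nor T⁺ has a nontrivial closed invariant ideal: the only closed solid subspaces of ℓ¹ invariant under |T| (respectively under T⁺) are {0} and ℓ¹. -/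

import Mathlib

open Filter Topology

namespace ReadOperator

/-- The real Banach space `ℓ¹`. -/
abbrev L1 := lp (fun _ : ℕ => ℝ) 1

/-- The standard unit vectors of `ℓ¹`. -/
noncomputable def f (i : ℕ) : L1 := lp.single 1 i (1 : ℝ)

lemma f_apply (i j : ℕ) : f i j = if j = i then 1 else 0 := by
  by_cases h : j = i
  · subst h; simp [f]
  · simp [f, h]

lemma norm_f (i : ℕ) : ‖f i‖ = 1 := by
  simp [f, lp.norm_single]

lemma f_ne_zero (i : ℕ) : f i ≠ 0 := by
  rw [← norm_ne_zero_iff, norm_f]; exact one_ne_zero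

lemma hasSum_norm (x : L1) : HasSum (fun i => |x i|) ‖x‖ := by
  have := lp.hasSum_norm (p := 1) (by norm_num) x
  simpa using this

lemma hasSum_f (x : L1) : HasSum (fun i => x i • f i) x := by
  have := lp.hasSum_single (p := 1) (by norm_num) x
  convert this using 2 with i
  rw [f, ← lp.single_smul]; simp

section

variable {E : Type*} [NormedAddCommGroup E] [NormedSpace ℝ E]

lemma summable_smul [CompleteSpace E] {c : ℕ → E} {C : ℝ} (h : ∀ i, ‖c i‖ ≤ C) (x : L1) :
    Summable (fun i => x i • c i) := by
  refine Summable.of_norm_bounded ((hasSum_norm x).summable.mul_right C) fun i => ?_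
  rw [norm_smul, Real.norm_eq_abs]
  exact mul_le_mul_of_nonneg_left (h i) (abs_nonneg _)

/-- The bounded operator on `ℓ¹` with prescribed uniformly bounded columns. -/
noncomputable def ofCols [CompleteSpace E] (c : ℕ → E) (C : ℝ) (h : ∀ i, ‖c i‖ ≤ C) : L1 →L[ℝ] E :=
  LinearMap.mkContinuous
    { toFun := fun x => ∑' i, x i • c i
      map_add' := fun x y => by
        rw [← (summable_smul h x).tsum_add (summable_smul h y)]
        simp [add_smul]
      map_smul' := fun a x => by
        rw [RingHom.id_apply, ← (summable_smul h x).tsum_const_smul]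
        simp [mul_smul] } C fun x => by
    have hs := (hasSum_norm x).mul_right C
    rw [mul_comm]
    refine tsum_of_norm_bounded hs fun i => ?_
    rw [norm_smul, Real.norm_eq_abs]
    exact mul_le_mul_of_nonneg_left (h i) (abs_nonneg _)

@[simp] lemma ofCols_f [CompleteSpace E] (c : ℕ → E) (C : ℝ) (h : ∀ i, ‖c i‖ ≤ C) (i : ℕ) :
    ofCols c C h (f i) = c i := by
  change ∑' k, f i k • c k = c i
  rw [tsum_eq_single i]
  · simp [f_apply]
  · intro k hk; simp [f_apply, hk]

lemma hasSum_apply (Z : L1 →L[ℝ] E) (x : L1) : HasSum (fun i => x i • Z (f i)) (Z x) := by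
  simpa using Z.hasSum (hasSum_f x)

lemma clm_ext {Z W : L1 →L[ℝ] E} (h : ∀ i, Z (f i) = W (f i)) : Z = W := by
  ext x
  refine (hasSum_apply Z x).unique ?_
  simpa [h] using hasSum_apply W x

lemma norm_apply_le (Z : L1 →L[ℝ] E) (x : L1) {g : ℕ → ℝ} (hg : Summable fun i => |x i| * g i)
    (h : ∀ i, ‖Z (f i)‖ ≤ g i) : ‖Z x‖ ≤ ∑' i, |x i| * g i := by
  rw [← (hasSum_apply Z x).tsum_eq]
  refine tsum_of_norm_bounded hg.hasSum fun i => ?_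
  rw [norm_smul, Real.norm_eq_abs]
  exact mul_le_mul_of_nonneg_left (h i) (abs_nonneg _)

lemma opNorm_le (Z : L1 →L[ℝ] E) {C : ℝ} (h : ∀ i, ‖Z (f i)‖ ≤ C) : ‖Z‖ ≤ C := by
  refine Z.opNorm_le_bound ((norm_nonneg _).trans (h 0)) fun x => ?_
  refine (norm_apply_le Z x ((hasSum_norm x).summable.mul_right C) h).trans ?_
  rw [((hasSum_norm x).mul_right C).tsum_eq, mul_comm]

end

lemma eq_top_of_f_mem {J : Submodule ℝ L1} (hc : IsClosed (J : Set L1)) (h : ∀ i, f i ∈ J) :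
    J = ⊤ := by
  rw [eq_top_iff]
  intro x _
  exact hc.mem_of_tendsto (hasSum_f x) (.of_forall fun s => J.sum_mem fun i _ => J.smul_mem _ (h i))

/-- Stage boundaries: stage `n` is the interval `[uu n, uu (n + 1))`. -/
def uu : ℕ → ℕ
  | 0 => 1
  | n + 1 => (n + 2) * (2 * uu n + 1)

/-- Distance between consecutive blocks of stage `n`. -/
def bb (n : ℕ) : ℕ := 2 * uu n + 1

lemma uu_succ (n : ℕ) : uu (n + 1) = (n + 2) * bb n := rfl

lemma uu_lt_succ (n : ℕ) : uu n < uu (n + 1) := by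
  rw [uu_succ, bb]; nlinarith

lemma uu_strictMono : StrictMono uu := strictMono_nat_of_lt_succ uu_lt_succ

lemma uu_pos (n : ℕ) : 0 < uu n := by
  have := uu_strictMono.monotone (Nat.zero_le n)
  exact lt_of_lt_of_le Nat.one_pos this

lemma lt_uu (n : ℕ) : n < uu n := by
  induction n with
  | zero => exact uu_pos 0
  | succ n ih => have := uu_lt_succ n; omega

lemma bb_pos (n : ℕ) : 0 < bb n := by rw [bb]; omega

/-- The stage containing the index `i`. -/
noncomputable def stg (i : ℕ) : ℕ := sInf {n | i < uu (n + 1)}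

lemma lt_uu_stg (i : ℕ) : i < uu (stg i + 1) :=
  Nat.sInf_mem (s := {n | i < uu (n + 1)}) ⟨i, (lt_uu i).trans (uu_lt_succ i)⟩

lemma stg_le {i n : ℕ} (h : i < uu (n + 1)) : stg i ≤ n := Nat.sInf_le h

lemma le_stg {i n : ℕ} (h : uu n ≤ i) : n ≤ stg i := by
  have := uu_strictMono.lt_iff_lt.1 (h.trans_lt (lt_uu_stg i))
  omega

lemma stg_eq {i n : ℕ} (h1 : uu n ≤ i) (h2 : i < uu (n + 1)) : stg i = n :=
  le_antisymm (stg_le h2) (le_stg h1)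

/-- `i` lies in one of the blocks of its stage. -/
def blk (i : ℕ) : Prop :=
  1 ≤ i / bb (stg i) ∧ i % bb (stg i) < uu (stg i + 1 - i / bb (stg i))

/-- The level of the block containing `i`; a block of level `s` has length `uu s`. -/
noncomputable def lev (i : ℕ) : ℕ := stg i + 1 - i / bb (stg i)

/-- The position of `i` inside its block. -/
noncomputable def off (i : ℕ) : ℕ := i % bb (stg i)

/-- The first index of the block of level `s` in stage `n`. -/
def start (n s : ℕ) : ℕ := (n + 1 - s) * bb n

section

variable {n s j : ℕ}

lemma start_add_lt (hs : s ≤ n) (hj : j ≤ uu s) : start n s + j < uu (n + 1) := by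
  have h1 := uu_strictMono.monotone hs
  have h2 : (n + 1 - s) * bb n ≤ (n + 1) * bb n := Nat.mul_le_mul_right _ (by omega)
  rw [uu_succ, start, show (n + 2) * bb n = (n + 1) * bb n + bb n by ring]
  have : bb n = 2 * uu n + 1 := rfl
  omega

lemma bb_le_start (hs : s ≤ n) : bb n ≤ start n s := by
  rw [start]; exact Nat.le_mul_of_pos_left _ (by omega)

lemma stg_start_add (hs : s ≤ n) (hj : j ≤ uu s) : stg (start n s + j) = n := by
  refine stg_eq ?_ (start_add_lt hs hj)
  have := bb_le_start hs
  have : bb n = 2 * uu n + 1 := rfl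
  omega

lemma lt_bb (hs : s ≤ n) (hj : j ≤ uu s) : j < bb n := by
  have h1 := uu_strictMono.monotone hs
  rw [bb]; omega

lemma start_add_div (hs : s ≤ n) (hj : j ≤ uu s) : (start n s + j) / bb n = n + 1 - s := by
  rw [start, mul_comm, Nat.mul_add_div (bb_pos n), Nat.div_eq_of_lt (lt_bb hs hj), add_zero]

lemma lev_start_add (hs : s ≤ n) (hj : j ≤ uu s) : lev (start n s + j) = s := by
  rw [lev, stg_start_add hs hj, start_add_div hs hj]; omega

lemma off_start_add (hs : s ≤ n) (hj : j ≤ uu s) : off (start n s + j) = j := by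
  rw [off, stg_start_add hs hj, start, Nat.mul_add_mod_of_lt (lt_bb hs hj)]

lemma blk_iff (i : ℕ) : blk i ↔ 1 ≤ i / bb (stg i) ∧ off i < uu (lev i) := Iff.rfl

lemma blk_start_add (hs : s ≤ n) (hj : j < uu s) : blk (start n s + j) := by
  rw [blk_iff, lev_start_add hs hj.le, off_start_add hs hj.le, stg_start_add hs hj.le,
    start_add_div hs hj.le]
  exact ⟨by omega, hj⟩

lemma not_blk_start_add (hs : s ≤ n) : ¬ blk (start n s + uu s) := by
  rw [blk_iff, lev_start_add hs le_rfl, off_start_add hs le_rfl]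
  simp

end

lemma blk.exists_eq {i : ℕ} (h : blk i) :
    ∃ n s j, s ≤ n ∧ j < uu s ∧ i = start n s + j := by
  refine ⟨stg i, lev i, off i, ?_, h.2, ?_⟩
  · have := h.1
    rw [lev]; omega
  · have h1 : i / bb (stg i) < stg i + 2 := by
      rw [Nat.div_lt_iff_lt_mul (bb_pos _)]
      exact lt_uu_stg i
    rw [start, lev, off, Nat.sub_sub_self (by omega : i / bb (stg i) ≤ stg i + 1),
      mul_comm, Nat.div_add_mod]

lemma blk.lev_le {i : ℕ} (h : blk i) : lev i ≤ stg i := by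
  have := h.1
  rw [lev]; omega

lemma blk.off_lt {i : ℕ} (h : blk i) : off i < uu (lev i) := h.2

lemma blk.off_lt_self {i : ℕ} (h : blk i) : off i + uu (stg i) < i := by
  obtain ⟨n, s, j, hs, hj, rfl⟩ := h.exists_eq
  have h1 := bb_le_start hs
  rw [off_start_add hs hj.le, stg_start_add hs hj.le]
  have : bb n = 2 * uu n + 1 := rfl
  omega

lemma blk.start_add_off {i : ℕ} (h : blk i) : start (stg i) (lev i) + off i = i := by
  obtain ⟨n, s, j, hs, hj, rfl⟩ := h.exists_eq
  rw [off_start_add hs hj.le, stg_start_add hs hj.le, lev_start_add hs hj.le]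

lemma not_blk_uu (s : ℕ) : ¬ blk (uu s) := by
  intro h
  have h1 := h.1
  rw [stg_eq le_rfl (uu_lt_succ s), Nat.div_eq_of_lt (by rw [bb]; omega)] at h1
  omega

lemma not_blk_zero : ¬ blk 0 := fun h => by simpa using h.1

lemma not_blk_one : ¬ blk 1 := not_blk_uu 0

lemma not_blk_two : ¬ blk 2 := by
  intro h
  have h1 := h.1
  rw [stg_eq (i := 2) (n := 0) (by decide) (by decide)] at h1
  revert h1; decide

/-- Block indices which are not the last one of their block. -/
def inner (i : ℕ) : Prop := blk i ∧ off i + 1 < uu (lev i)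

/-- The last indices of blocks. -/
def final (i : ℕ) : Prop := blk i ∧ off i + 1 = uu (lev i)

/-- The indices right before the blocks. -/
def before (i : ℕ) : Prop := blk (i + 1) ∧ off (i + 1) = 0

lemma inner.exists_eq {i : ℕ} (h : inner i) :
    ∃ n s j, s ≤ n ∧ j + 1 < uu s ∧ i = start n s + j := by
  obtain ⟨n, s, j, hs, hj, rfl⟩ := h.1.exists_eq
  have := h.2
  rw [off_start_add hs hj.le, lev_start_add hs hj.le] at this
  exact ⟨n, s, j, hs, this, rfl⟩

lemma final.exists_eq {i : ℕ} (h : final i) :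
    ∃ n s j, s ≤ n ∧ j + 1 = uu s ∧ i = start n s + j := by
  obtain ⟨n, s, j, hs, hj, rfl⟩ := h.1.exists_eq
  have := h.2
  rw [off_start_add hs hj.le, lev_start_add hs hj.le] at this
  exact ⟨n, s, j, hs, this, rfl⟩

lemma inner.blk_succ {i : ℕ} (h : inner i) : blk (i + 1) ∧ stg (i + 1) = stg i ∧
    lev (i + 1) = lev i ∧ off (i + 1) = off i + 1 := by
  obtain ⟨n, s, j, hs, hj, rfl⟩ := h.exists_eq
  have hj' : j ≤ uu s := by omega
  rw [add_assoc, stg_start_add hs hj.le, stg_start_add hs hj', lev_start_add hs hj.le,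
    lev_start_add hs hj', off_start_add hs hj.le, off_start_add hs hj']
  exact ⟨blk_start_add hs hj, rfl, rfl, rfl⟩

lemma final.not_blk_succ {i : ℕ} (h : final i) : ¬ blk (i + 1) ∧ stg (i + 1) = stg i := by
  obtain ⟨n, s, j, hs, hj, rfl⟩ := h.exists_eq
  rw [add_assoc, stg_start_add hs hj.le, stg_start_add hs (by omega), hj]
  exact ⟨not_blk_start_add hs, rfl⟩

lemma blk.inner_or_final {i : ℕ} (h : blk i) : inner i ∨ final i := by
  rcases (Nat.succ_le_of_lt h.off_lt).lt_or_eq with h1 | h1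
  · exact .inl ⟨h, h1⟩
  · exact .inr ⟨h, h1⟩

lemma inner.not_final {i : ℕ} (h : inner i) : ¬ final i := fun h' => h.2.ne h'.2

lemma inner.not_before {i : ℕ} (h : inner i) : ¬ before i := fun h' => by
  have := h.blk_succ.2.2.2
  have := h'.2
  omega

lemma final.not_before {i : ℕ} (h : final i) : ¬ before i := fun h' => h.not_blk_succ.1 h'.1

lemma before.not_blk {i : ℕ} (h : before i) : ¬ blk i := fun h' =>
  h'.inner_or_final.elim (fun h1 => h1.not_before h) fun h1 => h1.not_before h

lemma before_of_not_blk {i : ℕ} (h : ¬ blk i) (h' : blk (i + 1)) : before i := by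
  refine ⟨h', ?_⟩
  obtain ⟨n, s, j, hs, hj, hi⟩ := h'.exists_eq
  rw [hi, off_start_add hs hj.le]
  rcases j with _ | j
  · rfl
  · exact absurd (by rw [show i = start n s + j by omega]; exact blk_start_add hs (by omega)) h

lemma start_pos {n s : ℕ} (hs : s ≤ n) : 0 < start n s := (bb_pos n).trans_le (bb_le_start hs)

lemma before_start {n s : ℕ} (hs : s ≤ n) : before (start n s - 1) := by
  rw [before, Nat.sub_add_cancel (start_pos hs)]
  exact ⟨blk_start_add (j := 0) hs (uu_pos s), off_start_add (j := 0) hs (Nat.zero_le _)⟩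

/-- Admissible parameter sequences. -/
structure Adm (θ : ℕ → ℝ) : Prop where
  pos : ∀ n, 0 < θ n
  anti : Antitone θ
  le : θ 0 ≤ 1 / 4

section Weights

variable (θ : ℕ → ℝ)

/-- The shift weight at position `j` inside a block. -/
noncomputable def gam (j : ℕ) : ℝ := θ (stg (j + 1) + 1)

/-- The shift weight of stage `n` outside the blocks. -/
noncomputable def Dl (n : ℕ) : ℝ := θ n ^ uu n / (n + 2)

open Classical in
/-- The shift weights. -/
noncomputable def lam (i : ℕ) : ℝ := if inner i then gam θ (off i) else Dl θ (stg (i + 1))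

/-- The product of the first `i` shift weights. -/
noncomputable def Lam (i : ℕ) : ℝ := ∏ l ∈ Finset.range i, lam θ l

/-- The product of the first `j` block weights. -/
noncomputable def Gam (j : ℕ) : ℝ := ∏ l ∈ Finset.range j, gam θ l

open Classical in
/-- The perturbation coefficient at `i`. -/
noncomputable def kk (i : ℕ) : ℝ := if blk i then (lev i + 1) / Gam θ (off i) else 0

open Classical in
/-- The coefficient of `f 0` in the column `i`. -/
noncomputable def mu (i : ℕ) : ℝ := if before i then lam θ i * kk θ (i + 1) else 0

open Classical in
/-- The negative coefficient in the column `i`. -/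
noncomputable def nu (i : ℕ) : ℝ := if final i then kk θ i * Lam θ (off i + 1) else 0

/-- The columns of the operator. -/
noncomputable def col (i : ℕ) : L1 :=
  lam θ i • f (i + 1) + mu θ i • f 0 - nu θ i • f (off i + 1)

end Weights

section

variable {θ : ℕ → ℝ} {i : ℕ}

lemma Lam_zero (θ : ℕ → ℝ) : Lam θ 0 = 1 := by simp [Lam]

lemma Lam_succ (θ : ℕ → ℝ) (i : ℕ) : Lam θ (i + 1) = Lam θ i * lam θ i := Finset.prod_range_succ _ _

lemma Gam_zero (θ : ℕ → ℝ) : Gam θ 0 = 1 := by simp [Gam]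

lemma Gam_succ (θ : ℕ → ℝ) (i : ℕ) : Gam θ (i + 1) = Gam θ i * gam θ i := Finset.prod_range_succ _ _

lemma lam_of_not_inner (hi : ¬ inner i) : lam θ i = Dl θ (stg (i + 1)) := if_neg hi

lemma lam_of_not_blk_succ (hi : ¬ blk (i + 1)) : lam θ i = Dl θ (stg (i + 1)) :=
  lam_of_not_inner fun h => hi h.blk_succ.1

lemma lam_of_not_blk (hi : ¬ blk i) : lam θ i = Dl θ (stg (i + 1)) :=
  lam_of_not_inner fun h => hi h.1

lemma lam_of_inner (hi : inner i) : lam θ i = gam θ (off i) := if_pos hi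

lemma kk_of_not_blk (hi : ¬ blk i) : kk θ i = 0 := if_neg hi

lemma kk_of_blk (hi : blk i) : kk θ i = (lev i + 1) / Gam θ (off i) := if_pos hi

lemma mu_of_not_before (hi : ¬ before i) : mu θ i = 0 := if_neg hi

lemma mu_of_before (hi : before i) : mu θ i = lam θ i * kk θ (i + 1) := if_pos hi

lemma nu_of_not_final (hi : ¬ final i) : nu θ i = 0 := if_neg hi

lemma nu_of_final (hi : final i) : nu θ i = kk θ i * Lam θ (off i + 1) := if_pos hi

lemma norm_sum3_le (a b c : ℝ) (i j k : ℕ) :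
    ‖a • f i + b • f j - c • f k‖ ≤ |a| + |b| + |c| := by
  refine (norm_sub_le _ _).trans (add_le_add ((norm_add_le _ _).trans ?_) ?_) <;>
  simp [norm_smul, norm_f]

lemma col_of_inner (hi : inner i) : col θ i = gam θ (off i) • f (i + 1) := by
  rw [col, lam_of_inner hi, mu_of_not_before hi.not_before, nu_of_not_final hi.not_final]
  simp


lemma Adm.le_quarter (h : Adm θ) (n : ℕ) : θ n ≤ 1 / 4 := (h.anti (Nat.zero_le n)).trans h.le

lemma Adm.gam_pos (h : Adm θ) (j : ℕ) : 0 < gam θ j := h.pos _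

lemma Adm.Dl_pos (h : Adm θ) (n : ℕ) : 0 < Dl θ n := div_pos (pow_pos (h.pos n) _) (by positivity)

lemma Adm.lam_pos (h : Adm θ) (i : ℕ) : 0 < lam θ i := by
  unfold lam; split_ifs
  exacts [h.gam_pos _, h.Dl_pos _]

lemma Adm.Lam_pos (h : Adm θ) (i : ℕ) : 0 < Lam θ i := Finset.prod_pos fun _ _ => h.lam_pos _

lemma Adm.Gam_pos (h : Adm θ) (i : ℕ) : 0 < Gam θ i := Finset.prod_pos fun _ _ => h.gam_pos _

lemma Adm.kk_nonneg (h : Adm θ) (i : ℕ) : 0 ≤ kk θ i := by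
  unfold kk; split_ifs
  · exact div_nonneg (by positivity) (h.Gam_pos _).le
  · exact le_rfl

lemma Adm.mu_nonneg (h : Adm θ) (i : ℕ) : 0 ≤ mu θ i := by
  unfold mu; split_ifs
  · exact mul_nonneg (h.lam_pos _).le (h.kk_nonneg _)
  · exact le_rfl

lemma Adm.nu_nonneg (h : Adm θ) (i : ℕ) : 0 ≤ nu θ i := by
  unfold nu; split_ifs
  · exact mul_nonneg (h.kk_nonneg _) (h.Lam_pos _).le
  · exact le_rfl

lemma Adm.mul_Dl_le (h : Adm θ) (n : ℕ) : (n + 2) * Dl θ n ≤ θ n := by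
  rw [Dl, mul_div_cancel₀ _ (by positivity)]
  refine pow_le_of_le_one (h.pos n).le ?_ (uu_pos n).ne'
  have := h.le_quarter n
  linarith

lemma Adm.Dl_le_half (h : Adm θ) (n : ℕ) : Dl θ n ≤ θ n / 2 := by
  have h1 := h.mul_Dl_le n
  have h2 := h.Dl_pos n
  have h3 : 0 ≤ n * Dl θ n := by positivity
  linarith

lemma Adm.Dl_le (h : Adm θ) (n : ℕ) : Dl θ n ≤ θ n := by
  have := h.Dl_le_half n
  have := h.pos n
  linarith

lemma Adm.lam_le (h : Adm θ) (i : ℕ) : lam θ i ≤ 1 / 4 := by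
  unfold lam; split_ifs
  · exact h.le_quarter _
  · exact (h.Dl_le _).trans (h.le_quarter _)

lemma Adm.lam_le_one (h : Adm θ) (i : ℕ) : lam θ i ≤ 1 := (h.lam_le i).trans (by norm_num)

lemma Adm.gam_le_one (h : Adm θ) (i : ℕ) : gam θ i ≤ 1 := (h.le_quarter _).trans (by norm_num)

lemma Adm.Lam_le (h : Adm θ) (i : ℕ) : Lam θ i ≤ (1 / 4) ^ i := by
  induction i with
  | zero => simp [Lam_zero]
  | succ i ih =>
    rw [Lam_succ, pow_succ]
    exact mul_le_mul ih (h.lam_le i) (h.lam_pos i).le (by positivity)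

lemma Adm.Lam_anti (h : Adm θ) : Antitone (Lam θ) := antitone_nat_of_succ_le fun i => by
  rw [Lam_succ]; exact mul_le_of_le_one_right (h.Lam_pos i).le (h.lam_le_one i)

lemma Adm.Gam_anti (h : Adm θ) : Antitone (Gam θ) := antitone_nat_of_succ_le fun i => by
  rw [Gam_succ]; exact mul_le_of_le_one_right (h.Gam_pos i).le (h.gam_le_one i)

lemma Adm.Lam_le_one (h : Adm θ) (i : ℕ) : Lam θ i ≤ 1 := by
  simpa [Lam_zero] using h.Lam_anti (Nat.zero_le i)

lemma Adm.Lam_succ_le (h : Adm θ) (i : ℕ) : Lam θ (i + 1) ≤ lam θ i := by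
  rw [Lam_succ]; exact mul_le_of_le_one_left (h.lam_pos i).le (h.Lam_le_one i)

/-- Products of block weights within a block of level `s` are bounded below. -/
lemma Adm.pow_le_Gam (h : Adm θ) {s j : ℕ} (hj : j < uu s) : θ s ^ j ≤ Gam θ j := by
  have h1 : ∏ _l ∈ Finset.range j, θ s ≤ ∏ l ∈ Finset.range j, gam θ l := by
    refine Finset.prod_le_prod (fun _ _ => (h.pos s).le) fun l hl => h.anti ?_
    rw [Finset.mem_range] at hl
    rcases s with _ | s
    · have : uu 0 = 1 := rfl
      omega
    · exact Nat.succ_le_succ (stg_le (by omega))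
  rwa [Finset.prod_const, Finset.card_range] at h1

lemma Adm.Lam_uu_le (h : Adm θ) (s : ℕ) : Lam θ (uu s) ≤ Dl θ s := by
  have h1 : uu s - 1 + 1 = uu s := Nat.sub_add_cancel (uu_pos s)
  have := h.Lam_succ_le (uu s - 1)
  rw [lam_of_not_blk_succ (by rw [h1]; exact not_blk_uu s), h1,
    stg_eq le_rfl (uu_lt_succ s)] at this
  exact this

lemma Adm.nu_le (h : Adm θ) (hi : final i) : nu θ i ≤ θ (lev i) := by
  rw [nu_of_final hi, kk_of_blk hi.1, hi.2, div_mul_eq_mul_div, div_le_iff₀ (h.Gam_pos _)]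
  set s := lev i
  have hp : off i < uu s := hi.1.off_lt
  have h1 := h.Lam_uu_le s
  have h2 := h.pow_le_Gam hp
  have h3 : θ s * θ s ^ off i ≤ θ s * Gam θ (off i) := mul_le_mul_of_nonneg_left h2 (h.pos _).le
  refine le_trans ?_ h3
  rw [← pow_succ', hi.2]
  have h4 : (s + 1 : ℝ) * Lam θ (uu s) ≤ (s + 1) * Dl θ s :=
    mul_le_mul_of_nonneg_left h1 (by positivity)
  have h5 : (s + 2 : ℝ) * Dl θ s = θ s ^ uu s := by
    rw [Dl, mul_div_cancel₀ _ (by positivity)]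
  have := h.Dl_pos s
  linarith

lemma Adm.lam_add_mu_le (h : Adm θ) (hi : ¬ blk i) : lam θ i + mu θ i ≤ θ (stg (i + 1)) := by
  have hl := lam_of_not_blk (θ := θ) hi
  have hD := h.Dl_pos (stg (i + 1))
  by_cases hb : before i
  · rw [mu_of_before hb, kk_of_blk hb.1, hb.2, Gam_zero, hl]
    have h1 : (lev (i + 1) : ℝ) ≤ stg (i + 1) := by exact_mod_cast hb.1.lev_le
    have h2 := h.mul_Dl_le (stg (i + 1))
    nlinarith
  · rw [mu_of_not_before hb, hl, add_zero]; exact h.Dl_le _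

lemma Adm.norm_col_of_not_blk (h : Adm θ) (hi : ¬ blk i) : ‖col θ i‖ ≤ θ (stg (i + 1)) := by
  refine (norm_sum3_le _ _ _ _ _ _).trans ?_
  rw [nu_of_not_final fun h' => hi h'.1, abs_zero, add_zero, abs_of_pos (h.lam_pos i),
    abs_of_nonneg (h.mu_nonneg i)]
  exact h.lam_add_mu_le hi

lemma Adm.norm_col_of_final (h : Adm θ) (hi : final i) :
    ‖col θ i‖ ≤ θ (stg (i + 1)) + θ (lev i) := by
  refine (norm_sum3_le _ _ _ _ _ _).trans ?_
  rw [mu_of_not_before hi.not_before, abs_zero, add_zero, abs_of_pos (h.lam_pos i),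
    abs_of_nonneg (h.nu_nonneg i), lam_of_not_inner fun h' => h'.not_final hi]
  exact add_le_add (h.Dl_le _) (h.nu_le hi)

lemma Adm.norm_col_le (h : Adm θ) (i : ℕ) : ‖col θ i‖ ≤ 1 / 2 := by
  by_cases hi : blk i
  · rcases hi.inner_or_final with hi | hi
    · rw [col_of_inner hi, norm_smul, norm_f, mul_one, Real.norm_eq_abs,
        abs_of_pos (h.gam_pos _)]
      exact (h.le_quarter _).trans (by norm_num)
    · have := h.norm_col_of_final hi
      have := h.le_quarter (stg (i + 1))
      have := h.le_quarter (lev i)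
      linarith
  · exact (h.norm_col_of_not_blk hi).trans ((h.le_quarter _).trans (by norm_num))

/-- The quasinilpotent operator without invariant subspaces. -/
noncomputable def Adm.T (h : Adm θ) : L1 →L[ℝ] L1 := ofCols (col θ) (1 / 2) h.norm_col_le

lemma Adm.T_f (h : Adm θ) (i : ℕ) : h.T (f i) = col θ i := ofCols_f _ _ _ i

lemma Adm.norm_T_le (h : Adm θ) : ‖h.T‖ ≤ 1 / 2 :=
  opNorm_le _ fun i => by rw [h.T_f]; exact h.norm_col_le i

/-- The orbit of `f 0`. -/
noncomputable def Adm.e (h : Adm θ) (i : ℕ) : L1 := (h.T ^ i) (f 0)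

end

section

variable {θ : ℕ → ℝ} {i : ℕ}


lemma Adm.e_zero (h : Adm θ) : h.e 0 = f 0 := by simp [Adm.e]

lemma Adm.pow_e (h : Adm θ) (t i : ℕ) : (h.T ^ t) (h.e i) = h.e (i + t) := by
  rw [Adm.e, Adm.e, add_comm, pow_add]; rfl

lemma Adm.T_e (h : Adm θ) (i : ℕ) : h.T (h.e i) = h.e (i + 1) := by
  simpa using h.pow_e 1 i

lemma Adm.e_eq (h : Adm θ) (i : ℕ) : h.e i = Lam θ i • (f i + kk θ i • h.e (off i)) := by
  induction i using Nat.strong_induction_on with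
  | _ i ih =>
    rcases i with _ | i
    · rw [h.e_zero, Lam_zero, kk_of_not_blk not_blk_zero]; simp
    · rw [← h.T_e, ih i i.lt_succ_self, map_smul, map_add, map_smul, h.T_f, h.T_e, Lam_succ,
        mul_smul]
      congr 1
      by_cases hi : blk i
      · rcases hi.inner_or_final with hi' | hi'
        · have hb := hi'.blk_succ
          rw [col_of_inner hi', kk_of_blk hi, kk_of_blk hb.1, hb.2.2.1, hb.2.2.2, lam_of_inner hi',
            Gam_succ, smul_add, smul_smul]
          congr 2
          have := (h.gam_pos (off i)).ne'
          have := (h.Gam_pos (off i)).ne'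
          field_simp
        · have hlt := hi.off_lt_self
          rw [ih (off i + 1) (by omega), kk_of_not_blk hi'.not_blk_succ.1, hi'.2,
            kk_of_not_blk (not_blk_uu _), ← hi'.2, col, mu_of_not_before hi'.not_before,
            nu_of_final hi']
          simp only [zero_smul, add_zero, smul_smul]
          abel
      · rw [kk_of_not_blk hi, col, nu_of_not_final fun h' => hi h'.1]
        by_cases hb : blk (i + 1)
        · have hb' := before_of_not_blk hi hb
          rw [mu_of_before hb', hb'.2, h.e_zero]
          simp [mul_smul]
        · rw [mu_of_not_before fun h' => hb h'.1, kk_of_not_blk hb]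
          simp

lemma Adm.e_of_not_blk (h : Adm θ) (hi : ¬ blk i) : h.e i = Lam θ i • f i := by
  rw [h.e_eq, kk_of_not_blk hi]; simp

lemma Adm.f_eq (h : Adm θ) (i : ℕ) : f i = (Lam θ i)⁻¹ • h.e i - kk θ i • h.e (off i) := by
  conv_rhs => rw [h.e_eq i]
  rw [smul_smul, inv_mul_cancel₀ (h.Lam_pos i).ne', one_smul]
  abel

lemma Adm.norm_pow_le (h : Adm θ) (t : ℕ) : ‖h.T ^ t‖ ≤ 1 := by
  have : ‖h.T‖ ≤ 1 := h.norm_T_le.trans (by norm_num)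
  rcases t with _ | t
  · rw [pow_zero]; exact ContinuousLinearMap.norm_id_le
  · exact (norm_pow_le' _ t.succ_pos).trans (pow_le_one₀ (norm_nonneg _) this)

lemma Adm.norm_pow_apply_le (h : Adm θ) (t : ℕ) (x : L1) : ‖(h.T ^ t) x‖ ≤ ‖x‖ :=
  (h.T ^ t).le_of_opNorm_le (h.norm_pow_le t) x |>.trans (one_mul _).le

lemma Adm.norm_e_anti (h : Adm θ) : Antitone fun i => ‖h.e i‖ := fun i j hij => by
  obtain ⟨t, rfl⟩ := Nat.exists_eq_add_of_le hij
  change ‖h.e (i + t)‖ ≤ ‖h.e i‖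
  rw [← h.pow_e]; exact h.norm_pow_apply_le _ _

lemma Adm.norm_e_le_one (h : Adm θ) (i : ℕ) : ‖h.e i‖ ≤ 1 := by
  simpa [h.e_zero, norm_f] using h.norm_e_anti (Nat.zero_le i)

lemma Adm.norm_e_of_not_blk (h : Adm θ) (hi : ¬ blk i) : ‖h.e i‖ = Lam θ i := by
  rw [h.e_of_not_blk hi, norm_smul, norm_f, mul_one, Real.norm_eq_abs, abs_of_pos (h.Lam_pos i)]

lemma Adm.norm_e_le (h : Adm θ) {m : ℕ} (hi : uu m ≤ i) : ‖h.e i‖ ≤ θ m := by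
  refine (h.norm_e_anti hi).trans ?_
  change ‖h.e (uu m)‖ ≤ θ m
  rw [h.norm_e_of_not_blk (not_blk_uu m)]
  exact (h.Lam_uu_le m).trans (h.Dl_le m)

/-- Inside a block the operator acts as a weighted shift. -/
lemma Adm.pow_f (h : Adm θ) {n s j t : ℕ} (hs : s ≤ n) (hj : j + t < uu s) :
    (h.T ^ t) (f (start n s + j)) = (Gam θ (j + t) / Gam θ j) • f (start n s + j + t) := by
  induction t with
  | zero => simp [div_self (h.Gam_pos j).ne']
  | succ t ih =>
    have hi : inner (start n s + (j + t)) :=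
      ⟨blk_start_add hs (by omega), by
        rw [off_start_add hs (by omega), lev_start_add hs (by omega)]; omega⟩
    rw [pow_succ', mul_apply_eq_comp, ih (by omega), map_smul, add_assoc, h.T_f,
      col_of_inner hi, off_start_add hs (by omega), smul_smul, ← add_assoc j, Gam_succ]
    congr 1
    · ring
    · congr 1; ring

lemma Adm.ratio_le_one (h : Adm θ) (j t : ℕ) : Gam θ (j + t) / Gam θ j ≤ 1 :=
  div_le_one_of_le₀ (h.Gam_anti (Nat.le_add_right _ _)) (h.Gam_pos _).le

lemma Adm.norm_pow_f_of_high (h : Adm θ) {m n s j : ℕ} (hs : s ≤ n) (hm : m + 1 ≤ s)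
    (hj : j < uu s) :
    ‖(h.T ^ uu m) (f (start n s + j))‖ ≤ 2 * θ (m + 1) := by
  have hmp := h.pos (m + 1)
  by_cases hlt : j + uu m < uu s
  · rw [h.pow_f hs hlt, norm_smul, norm_f, mul_one, Real.norm_eq_abs,
      abs_of_pos (div_pos (h.Gam_pos _) (h.Gam_pos _)), div_le_iff₀ (h.Gam_pos _)]
    obtain ⟨v, hv⟩ : ∃ v, uu m = v + 1 := ⟨uu m - 1, (Nat.sub_add_cancel (uu_pos m)).symm⟩
    rw [hv, ← add_assoc, Gam_succ, mul_comm]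
    have h1 : gam θ (j + v) ≤ θ (m + 1) := h.anti (Nat.succ_le_succ (le_stg (by omega)))
    have h2 := h.Gam_anti (Nat.le_add_right j v)
    have := mul_le_mul h1 h2 (h.Gam_pos _).le hmp.le
    have := mul_pos hmp (h.Gam_pos j)
    linarith
  · obtain ⟨t, ht⟩ : ∃ t, j + t + 1 = uu s := ⟨uu s - j - 1, by omega⟩
    obtain ⟨w, hw⟩ : ∃ w, uu m = w + (1 + t) := ⟨uu m - (1 + t), by omega⟩
    have hi : final (start n s + (j + t)) :=
      ⟨blk_start_add hs (by omega), by
        rw [off_start_add hs (by omega), lev_start_add hs (by omega), ht]⟩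
    rw [hw, pow_add, pow_add, pow_one, mul_apply_eq_comp,
      mul_apply_eq_comp, h.pow_f hs (by omega)]
    refine (h.norm_pow_apply_le _ _).trans ?_
    rw [map_smul, norm_smul, Real.norm_eq_abs,
      abs_of_pos (div_pos (h.Gam_pos _) (h.Gam_pos _)), add_assoc, h.T_f]
    have h1 := h.norm_col_of_final hi
    rw [hi.not_blk_succ.2, stg_start_add hs (by omega), lev_start_add hs (by omega)] at h1
    have h2 := h.anti hm
    have h3 := h.anti (hm.trans hs)
    refine (mul_le_of_le_one_left (norm_nonneg _) (h.ratio_le_one j t)).trans ?_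
    linarith

lemma Adm.norm_e_of_low (h : Adm θ) {m n s j : ℕ} (hs : s ≤ n) (hm : s ≤ m) (hn : m + 1 ≤ n)
    (hj : j < uu s) :
    ‖h.e (start n s + j + uu m)‖ ≤ Lam θ (start n s + j) * θ (m + 1) := by
  have h1 := uu_strictMono.monotone hm
  have hb := not_blk_start_add hs
  obtain ⟨q, hq⟩ : ∃ q, start n s + uu s = q + 1 := ⟨start n s + uu s - 1, by omega⟩
  refine (h.norm_e_anti (show start n s + uu s ≤ _ by omega)).trans ?_
  change ‖h.e (start n s + uu s)‖ ≤ _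
  rw [h.norm_e_of_not_blk hb, hq, Lam_succ, lam_of_not_blk_succ (by rwa [← hq]), ← hq,
    stg_start_add hs le_rfl]
  exact mul_le_mul (h.Lam_anti (by omega)) ((h.Dl_le n).trans (h.anti hn)) (h.Dl_pos n).le
    (h.Lam_pos _).le

/-- A lower bound for the weights up to stage `m`. -/
noncomputable def ell (θ : ℕ → ℝ) (m : ℕ) : ℝ := Dl θ m ^ uu (m + 1)

lemma Adm.ell_pos (h : Adm θ) (m : ℕ) : 0 < ell θ m := pow_pos (h.Dl_pos m) _

lemma Adm.Dl_anti (h : Adm θ) : Antitone (Dl θ) := antitone_nat_of_succ_le fun n => by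
  have h0 := h.pos (n + 1)
  have h1 : θ (n + 1) ^ uu (n + 1) ≤ θ n ^ uu n :=
    (pow_le_pow_of_le_one h0.le ((h.le_quarter _).trans (by norm_num)) (uu_lt_succ n).le).trans
      (pow_le_pow_left₀ h0.le (h.anti n.le_succ) _)
  refine div_le_div₀ (pow_pos (h.pos n) _).le h1 (by positivity) ?_
  push_cast; linarith

lemma Adm.Dl_le_one (h : Adm θ) (n : ℕ) : Dl θ n ≤ 1 :=
  (h.Dl_le n).trans ((h.le_quarter n).trans (by norm_num))

lemma Adm.ell_le_Dl (h : Adm θ) (m : ℕ) : ell θ m ≤ Dl θ m :=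
  pow_le_of_le_one (h.Dl_pos m).le (h.Dl_le_one m) (uu_pos _).ne'

lemma Adm.ell_le_one (h : Adm θ) (m : ℕ) : ell θ m ≤ 1 := (h.ell_le_Dl m).trans (h.Dl_le_one m)

lemma Adm.Dl_le_lam (h : Adm θ) {m : ℕ} (hi : i + 1 < uu (m + 1)) : Dl θ m ≤ lam θ i := by
  by_cases hn : inner i
  · rw [lam_of_inner hn]
    refine (h.Dl_le m).trans (h.anti ?_)
    have h1 := hn.1.lev_le
    have h2 : stg i ≤ m := stg_le (by omega)
    have h3 := hn.2
    have h4 : stg (off i + 1) + 1 ≤ lev i := by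
      rcases hl : lev i with _ | l
      · have : uu 0 = 1 := rfl
        rw [hl] at h3
        omega
      · rw [hl] at h3
        exact Nat.succ_le_succ (stg_le h3)
    omega
  · rw [lam_of_not_inner hn]
    exact h.Dl_anti (stg_le hi)

lemma Adm.ell_le_Lam (h : Adm θ) {m : ℕ} (hi : i < uu (m + 1)) : ell θ m ≤ Lam θ i := by
  have h1 : ∏ _l ∈ Finset.range i, Dl θ m ≤ ∏ l ∈ Finset.range i, lam θ l := by
    refine Finset.prod_le_prod (fun _ _ => (h.Dl_pos m).le) fun l hl => h.Dl_le_lam ?_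
    rw [Finset.mem_range] at hl
    omega
  rw [Finset.prod_const, Finset.card_range] at h1
  exact (pow_le_pow_of_le_one (h.Dl_pos m).le (h.Dl_le_one m) hi.le).trans h1

lemma Adm.kk_le (h : Adm θ) {m : ℕ} (hi : lev i ≤ m) : kk θ i ≤ (ell θ m)⁻¹ := by
  by_cases hb : blk i
  · rw [kk_of_blk hb]
    have h1 := h.pow_le_Gam hb.off_lt
    have h2 := h.Dl_anti hi
    have h3 := h.ell_le_Dl m
    have h4 : (θ (lev i)) ^ uu (lev i) ≤ θ (lev i) ^ off i :=
      pow_le_pow_of_le_one (h.pos _).le ((h.le_quarter _).trans (by norm_num)) hb.off_lt.le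
    have h5 : ell θ m ≤ Gam θ (off i) / (lev i + 2) := by
      refine (h3.trans h2).trans ?_
      exact div_le_div_of_nonneg_right (h4.trans h1) (by positivity)
    rw [← one_div, le_div_iff₀ (h.ell_pos m), div_mul_eq_mul_div, div_le_one (h.Gam_pos _)]
    rw [le_div_iff₀ (by positivity)] at h5
    have := h.ell_pos m
    nlinarith
  · rw [kk_of_not_blk hb]; exact (inv_pos.2 (h.ell_pos m)).le

open Classical in
/-- The values of the coordinate functionals on the unit vectors. -/
noncomputable def alphaCol (θ : ℕ → ℝ) (m k i : ℕ) : ℝ :=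
  (if i < uu (m + 1) ∧ i = k then (Lam θ i)⁻¹ else 0) -
    if (blk i ∧ lev i ≤ m) ∧ off i = k then kk θ i else 0

lemma Adm.norm_alphaCol_le (h : Adm θ) (m k i : ℕ) : ‖alphaCol θ m k i‖ ≤ 2 * (ell θ m)⁻¹ := by
  have h0 := inv_pos.2 (h.ell_pos m)
  rw [alphaCol, two_mul]
  refine (norm_sub_le _ _).trans (add_le_add ?_ ?_)
  · split_ifs with hc
    · rw [Real.norm_eq_abs, abs_of_pos (inv_pos.2 (h.Lam_pos i))]
      exact inv_anti₀ (h.ell_pos m) (h.ell_le_Lam hc.1)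
    · simpa using h0.le
  · split_ifs with hc
    · rw [Real.norm_eq_abs, abs_of_nonneg (h.kk_nonneg i)]
      exact h.kk_le hc.1.2
    · simpa using h0.le

/-- The coordinate functionals of the approximate expansion of a vector along the orbit. -/
noncomputable def Adm.alpha (h : Adm θ) (m k : ℕ) : L1 →L[ℝ] ℝ :=
  ofCols (alphaCol θ m k) _ (h.norm_alphaCol_le m k)

lemma Adm.alpha_f (h : Adm θ) (m k i : ℕ) : h.alpha m k (f i) = alphaCol θ m k i := ofCols_f _ _ _ i

lemma Adm.norm_alpha_le (h : Adm θ) (m k : ℕ) : ‖h.alpha m k‖ ≤ 2 * (ell θ m)⁻¹ :=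
  opNorm_le _ fun i => by rw [h.alpha_f]; exact h.norm_alphaCol_le m k i

/-- Partial sums of the approximate expansion. -/
noncomputable def Adm.V (h : Adm θ) (m D : ℕ) : L1 →L[ℝ] L1 :=
  ∑ k ∈ Finset.range D, (h.alpha m k).smulRight (h.e k)

lemma Adm.V_apply (h : Adm θ) (m D : ℕ) (x : L1) :
    h.V m D x = ∑ k ∈ Finset.range D, h.alpha m k x • h.e k := by
  simp [Adm.V]

open Classical in
lemma Adm.V_f (h : Adm θ) {m D : ℕ} (h1 : uu m ≤ D) (h2 : D ≤ uu (m + 1)) (i : ℕ) :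
    h.V m D (f i) = (if i < D then (Lam θ i)⁻¹ • h.e i else 0) -
      if blk i ∧ lev i ≤ m then kk θ i • h.e (off i) else 0 := by
  rw [h.V_apply]
  simp only [h.alpha_f, alphaCol, sub_smul, Finset.sum_sub_distrib]
  congr 1
  · split_ifs with hi
    · rw [Finset.sum_eq_single_of_mem i (Finset.mem_range.2 hi)]
      · rw [if_pos ⟨hi.trans_le h2, rfl⟩]
      · intro k _ hk
        rw [if_neg fun h' => hk h'.2.symm, zero_smul]
    · refine Finset.sum_eq_zero fun k hk => ?_
      rw [Finset.mem_range] at hk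
      rw [if_neg fun h' => by omega, zero_smul]
  · split_ifs with hi
    · have h3 := hi.1.off_lt
      have h4 := uu_strictMono.monotone hi.2
      rw [Finset.sum_eq_single_of_mem (off i) (Finset.mem_range.2 (by omega))]
      · rw [if_pos ⟨hi, rfl⟩]
      · intro k _ hk
        rw [if_neg fun h' => hk h'.2.symm, zero_smul]
    · refine Finset.sum_eq_zero fun k hk => ?_
      rw [if_neg fun h' => hi h'.1, zero_smul]

lemma Adm.V_f_of_lt (h : Adm θ) {m D : ℕ} (h1 : uu m ≤ D) (h2 : D ≤ uu (m + 1)) (hi : i < D) :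
    h.V m D (f i) = f i := by
  classical
  rw [h.V_f h1 h2, if_pos hi, h.f_eq i]
  congr 1
  by_cases hb : blk i
  · have h3 : lev i ≤ m := hb.lev_le.trans (stg_le (by omega))
    rw [if_pos ⟨hb, h3⟩]
  · rw [if_neg fun h' => hb h'.1, kk_of_not_blk hb, zero_smul]

lemma Adm.norm_V_f_le (h : Adm θ) {m D : ℕ} (h1 : uu m ≤ D) (h2 : D ≤ uu (m + 1)) (hi : D ≤ i) :
    ‖h.V m D (f i)‖ ≤ kk θ i := by
  classical
  rw [h.V_f h1 h2, if_neg (by omega), zero_sub, norm_neg]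
  split_ifs
  · rw [norm_smul, Real.norm_eq_abs, abs_of_nonneg (h.kk_nonneg i)]
    exact mul_le_of_le_one_right (h.kk_nonneg i) (h.norm_e_le_one _)
  · simpa using h.kk_nonneg i

/-- The tail of the expansion is almost annihilated by a power of the operator. -/
lemma Adm.norm_tail_le (h : Adm θ) (m : ℕ) :
    ‖h.T ^ uu m * (1 - h.V m (uu (m + 1)))‖ ≤ 2 * θ (m + 1) := by
  classical
  have hm := h.pos (m + 1)
  have hlt := uu_lt_succ m
  refine opNorm_le _ fun i => ?_
  rw [mul_apply_eq_comp, sub_apply,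
    one_apply_eq_self]
  by_cases hi : i < uu (m + 1)
  · rw [h.V_f_of_lt hlt.le le_rfl hi]
    simpa using hm.le
  rw [h.V_f hlt.le le_rfl, if_neg hi, zero_sub, sub_neg_eq_add]
  by_cases hb : blk i
  · have hstg : m + 1 ≤ stg i := le_stg (by omega)
    by_cases hl : lev i ≤ m
    · rw [if_pos ⟨hb, hl⟩]
      conv_lhs => rw [h.f_eq i]
      rw [sub_add_cancel, map_smul, h.pow_e, norm_smul, Real.norm_eq_abs,
        abs_of_pos (inv_pos.2 (h.Lam_pos i)), inv_mul_le_iff₀ (h.Lam_pos i)]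
      have := h.norm_e_of_low hb.lev_le hl hstg hb.off_lt
      rw [hb.start_add_off] at this
      have := mul_pos (h.Lam_pos i) hm
      linarith
    · rw [if_neg fun h' => hl h'.2, add_zero]
      have := h.norm_pow_f_of_high hb.lev_le (not_le.1 hl) hb.off_lt
      rwa [hb.start_add_off] at this
  · rw [if_neg fun h' => hb h'.1, add_zero]
    obtain ⟨v, hv⟩ : ∃ v, uu m = v + 1 := ⟨uu m - 1, (Nat.sub_add_cancel (uu_pos m)).symm⟩
    rw [hv, pow_succ, mul_apply_eq_comp, h.T_f]
    refine (h.norm_pow_apply_le _ _).trans ((h.norm_col_of_not_blk hb).trans ?_)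
    have := h.anti (show m + 1 ≤ stg (i + 1) from le_stg (by omega))
    linarith

end

section

lemma tendsto_const_root {C : ℝ} (hC : 0 < C) :
    Tendsto (fun n : ℕ => C ^ (1 / (n : ℝ))) atTop (𝓝 1) := by
  have := (Real.continuousAt_const_rpow (a := C) (b := 0) hC.ne').tendsto.comp
    (tendsto_one_div_atTop_nhds_zero_nat (𝕜 := ℝ))
  simpa [Function.comp_def] using this

lemma tendsto_root_zero {a : ℕ → ℝ} (ha : ∀ n, 0 ≤ a n)
    (h : ∀ δ : ℝ, 0 < δ → ∃ C : ℝ, ∀ᶠ n in atTop, a n ≤ C * δ ^ n) :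
    Tendsto (fun n : ℕ => a n ^ (1 / (n : ℝ))) atTop (𝓝 0) := by
  rw [Metric.tendsto_nhds]
  intro ε hε
  obtain ⟨C, hC⟩ := h (ε / 2) (half_pos hε)
  have hC1 : 0 < max C 1 := lt_max_of_lt_right one_pos
  filter_upwards [hC, (tendsto_const_root hC1).eventually_lt_const one_lt_two,
    eventually_ne_atTop 0] with n h1 h2 hn
  have h0 := Real.rpow_nonneg (ha n) (1 / (n : ℝ))
  rw [Real.dist_eq, sub_zero, abs_of_nonneg h0]
  have h3 : a n ≤ max C 1 * (ε / 2) ^ n :=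
    h1.trans (mul_le_mul_of_nonneg_right (le_max_left _ _) (by positivity))
  have h4 := Real.rpow_le_rpow (ha n) h3 (show 0 ≤ 1 / (n : ℝ) by positivity)
  rw [Real.mul_rpow hC1.le (by positivity), one_div, Real.pow_rpow_inv_natCast (by positivity) hn]
    at h4
  rw [one_div] at h2 ⊢
  nlinarith

lemma tendsto_root_one {a : ℕ → ℝ} {C : ℝ} (h1 : ∀ n, 1 ≤ a n) (hC : ∀ n, a n ≤ C) :
    Tendsto (fun n : ℕ => a n ^ (1 / (n : ℝ))) atTop (𝓝 1) := by
  have hC0 : 0 < C := one_pos.trans_le ((h1 0).trans (hC 0))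
  refine tendsto_of_tendsto_of_tendsto_of_le_of_le tendsto_const_nhds (tendsto_const_root hC0)
    (fun n => Real.one_le_rpow (h1 n) (by positivity)) fun n => ?_
  exact Real.rpow_le_rpow (zero_le_one.trans (h1 n)) (hC n) (by positivity)

variable {θ : ℕ → ℝ}


lemma Adm.norm_pow_uu_le (h : Adm θ) (m : ℕ) :
    ‖h.T ^ uu (m + 1)‖ ≤ (2 + uu (m + 1) * (2 * (ell θ m)⁻¹)) * θ (m + 1) := by
  have hlt := uu_lt_succ m
  have hθ := h.pos (m + 1)
  have h0 := inv_pos.2 (h.ell_pos m)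
  set V := h.V m (uu (m + 1))
  have hdec : h.T ^ uu (m + 1) = h.T ^ (uu (m + 1) - uu m) * (h.T ^ uu m * (1 - V)) +
      h.T ^ uu (m + 1) * V := by
    rw [← mul_assoc, ← pow_add, Nat.sub_add_cancel hlt.le, mul_sub, mul_one]
    abel
  have h1 : ‖h.T ^ (uu (m + 1) - uu m) * (h.T ^ uu m * (1 - V))‖ ≤ 2 * θ (m + 1) := by
    refine (norm_mul_le _ _).trans ?_
    have := h.norm_tail_le m
    have := mul_le_mul (h.norm_pow_le (uu (m + 1) - uu m)) this (norm_nonneg _) zero_le_one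
    linarith
  have h2 : ‖h.T ^ uu (m + 1) * V‖ ≤ uu (m + 1) * (2 * (ell θ m)⁻¹) * θ (m + 1) := by
    refine ContinuousLinearMap.opNorm_le_bound _ (by positivity) fun x => ?_
    rw [mul_apply_eq_comp, h.V_apply, map_sum]
    refine (norm_sum_le _ _).trans ((Finset.sum_le_card_nsmul _ _
      (2 * (ell θ m)⁻¹ * ‖x‖ * θ (m + 1)) fun k _ => ?_).trans ?_)
    · rw [map_smul, h.pow_e, norm_smul]
      exact mul_le_mul ((h.alpha m k).le_of_opNorm_le (h.norm_alpha_le m k) x)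
        (h.norm_e_le (by omega)) (norm_nonneg _) (by positivity)
    · rw [Finset.card_range, nsmul_eq_mul]
      apply le_of_eq; ring
  rw [hdec]
  refine (norm_add_le _ _).trans ?_
  linarith

lemma Adm.norm_pow_le_geom (h : Adm θ)
    (hq : ∀ m, (2 + uu (m + 1) * (2 * (ell θ m)⁻¹)) * θ (m + 1) ≤ (1 / (m + 2 : ℝ)) ^ uu (m + 1))
    {δ : ℝ} (hδ : 0 < δ) : ∀ᶠ n in atTop, ‖h.T ^ n‖ ≤ δ ^ n := by
  obtain ⟨m, hm⟩ := exists_nat_one_div_lt (pow_pos hδ 2)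
  have hm' : 1 / (m + 2 : ℝ) ≤ δ ^ 2 := le_trans (by gcongr; norm_num) hm.le
  set L := uu (m + 1)
  have hL : ‖h.T ^ L‖ ≤ (δ ^ 2) ^ L :=
    (h.norm_pow_uu_le m).trans ((hq m).trans (pow_le_pow_left₀ (by positivity) hm' _))
  filter_upwards [eventually_ge_atTop L] with n hn
  rcases le_total 1 δ with h1 | h1
  · exact (h.norm_pow_le n).trans (one_le_pow₀ h1)
  have hLpos : 0 < L := uu_pos _
  have hqpos : 0 < n / L := Nat.div_pos hn hLpos
  have hdm := Nat.div_add_mod n L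
  have hml := Nat.mod_lt n hLpos
  have hLq : L ≤ L * (n / L) := Nat.le_mul_of_pos_right _ hqpos
  have hle : n ≤ 2 * (L * (n / L)) := by omega
  calc ‖h.T ^ n‖ = ‖(h.T ^ L) ^ (n / L) * h.T ^ (n % L)‖ := by
        rw [← pow_mul, ← pow_add, hdm]
    _ ≤ ‖(h.T ^ L) ^ (n / L)‖ * 1 :=
        (norm_mul_le _ _).trans (mul_le_mul_of_nonneg_left (h.norm_pow_le _) (norm_nonneg _))
    _ ≤ ((δ ^ 2) ^ L) ^ (n / L) := by
        rw [mul_one]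
        exact (norm_pow_le' _ hqpos).trans (pow_le_pow_left₀ (norm_nonneg _) hL _)
    _ = δ ^ (2 * (L * (n / L))) := by rw [← pow_mul, ← pow_mul]
    _ ≤ δ ^ n := pow_le_pow_of_le_one hδ.le h1 hle

end

section

open Polynomial

/-- The polynomial with given coefficients. -/
noncomputable def toPoly {D : ℕ} (α : Fin D → ℝ) : ℝ[X] := ∑ k : Fin D, C (α k) * X ^ (k : ℕ)

lemma coeff_toPoly {D : ℕ} (α : Fin D → ℝ) (k : Fin D) : (toPoly α).coeff k = α k := by
  simp [toPoly, coeff_X_pow, Fin.val_inj]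

lemma coeff_mul_toPoly {D : ℕ} (p : ℝ[X]) (α : Fin D → ℝ) (i : ℕ) :
    (p * toPoly α).coeff i = ∑ k : Fin D, α k * (p * X ^ (k : ℕ)).coeff i := by
  rw [toPoly, Finset.mul_sum, finsetSum_coeff]
  refine Finset.sum_congr rfl fun k _ => ?_
  rw [← coeff_C_mul]; congr 1; ring

lemma exists_mul_toPoly {D R d : ℕ} (α : Fin D → ℝ) (k : Fin D) (hk : k + d ≤ R) (hα : α k ≠ 0) :
    ∃ g : ℝ[X], ∀ i < D, (X ^ d * g * toPoly α).coeff i = if i = R then 1 else 0 := by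
  have hQ : toPoly α ≠ 0 := fun h0 => hα (by rw [← coeff_toPoly α k, h0, coeff_zero])
  obtain ⟨u, hu, hXu⟩ := exists_eq_pow_rootMultiplicity_mul_and_not_dvd (toPoly α) hQ 0
  rw [C_0, sub_zero] at hu hXu
  set n := rootMultiplicity 0 (toPoly α)
  have hn : n ≤ k := by
    by_contra hlt
    have : X ^ n ∣ toPoly α := ⟨u, hu⟩
    rw [X_pow_dvd_iff] at this
    exact hα (by rw [← coeff_toPoly α k]; exact this k (not_le.1 hlt))
  obtain ⟨w, v, hwv⟩ : IsCoprime u (X ^ D) :=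
    ((irreducible_X.coprime_iff_not_dvd).2 hXu).symm.pow_right
  refine ⟨X ^ (R - n - d) * w, fun i hi => ?_⟩
  have : X ^ d * (X ^ (R - n - d) * w) * toPoly α = X ^ R - v * X ^ R * X ^ D := by
    have hR : (X : ℝ[X]) ^ R = X ^ d * X ^ (R - n - d) * X ^ n := by
      rw [← pow_add, ← pow_add]; congr 1; omega
    have : X ^ R - v * X ^ R * X ^ D = X ^ R * (w * u) := by
      rw [eq_sub_of_add_eq hwv]; ring
    rw [hu, this, hR]; ring
  rw [this, coeff_sub, coeff_X_pow, coeff_mul_X_pow', if_neg (not_le.2 hi), sub_zero]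

/-- A uniform version of the approximate division of `X ^ R` by polynomials with bounded
coefficients having a low coefficient bounded away from zero. -/
lemma exists_uniform_multiplier (D R d : ℕ) (B η tol : ℝ) (hη : 0 < η) (htol : 0 < tol) :
    ∃ M : ℕ, ∀ α : Fin D → ℝ, (∀ k, |α k| ≤ B) → (∃ k : Fin D, k + d ≤ R ∧ η ≤ |α k|) →
      ∃ g : ℝ[X], g.natDegree ≤ M ∧ (∀ i, |g.coeff i| ≤ M) ∧
        ∀ i < D, |(X ^ d * g * toPoly α).coeff i - if i = R then 1 else 0| ≤ tol := by
  set K : Set (Fin D → ℝ) :=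
    Metric.closedBall 0 (max B 0) ∩ ⋃ k : Fin D, ⋃ (_ : k + d ≤ R), {α | η ≤ |α k|}
  have hK : IsCompact K := by
    refine (isCompact_closedBall _ _).inter_right (isClosed_iUnion_of_finite fun k =>
      isClosed_iUnion_of_finite fun _ => ?_)
    exact isClosed_le continuous_const (continuous_apply k).abs
  set U : ℕ → Set (Fin D → ℝ) := fun M => ⋃ g : ℝ[X],
    ⋃ (_ : g.natDegree ≤ M ∧ ∀ i, |g.coeff i| ≤ M), ⋂ i : Fin D,
      {α | |(X ^ d * g * toPoly α).coeff i - if (i : ℕ) = R then 1 else 0| < tol}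
  have hU : ∀ M, IsOpen (U M) := fun M =>
    isOpen_iUnion fun g => isOpen_iUnion fun _ => isOpen_iInter_of_finite fun i => by
      refine isOpen_lt ?_ continuous_const
      simp only [coeff_mul_toPoly]
      fun_prop
  have hmono : Monotone U := fun M N hMN α hα => by
    simp only [U, Set.mem_iUnion] at hα ⊢
    obtain ⟨g, ⟨h1, h2⟩, h3⟩ := hα
    exact ⟨g, ⟨h1.trans hMN, fun i => (h2 i).trans (by exact_mod_cast hMN)⟩, h3⟩
  have hcov : K ⊆ ⋃ M, U M := by
    rintro α ⟨-, hα⟩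
    simp only [Set.mem_iUnion] at hα
    obtain ⟨k, hk, hα⟩ := hα
    obtain ⟨g, hg⟩ := exists_mul_toPoly α k hk (abs_pos.1 (hη.trans_le hα))
    obtain ⟨N, hN⟩ : ∃ N : ℕ, ∀ i ∈ g.support, |g.coeff i| ≤ N := by
      obtain ⟨N, hN⟩ := exists_nat_ge (∑ i ∈ g.support, |g.coeff i|)
      exact ⟨N, fun i hi => (Finset.single_le_sum (f := fun i => |g.coeff i|)
        (fun _ _ => abs_nonneg _) hi).trans hN⟩
    simp only [U, Set.mem_iUnion, Set.mem_iInter]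
    refine ⟨max g.natDegree N, g, ⟨le_max_left _ _, fun i => ?_⟩, fun i => ?_⟩
    · by_cases hi : i ∈ g.support
      · exact (hN i hi).trans (by exact_mod_cast le_max_right _ _)
      · rw [notMem_support_iff.1 hi, abs_zero]; positivity
    · rw [Set.mem_ofPred_eq, hg i i.2, sub_self, abs_zero]; exact htol
  obtain ⟨M, hM⟩ := hK.elim_directed_cover U hU hcov (directed_of_isDirected_le hmono)
  refine ⟨M, fun α h1 h2 => ?_⟩
  have hα : α ∈ K := by
    refine ⟨?_, ?_⟩
    · rw [mem_closedBall_zero_iff, pi_norm_le_iff_of_nonneg (le_max_right _ _)]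
      exact fun k => (h1 k).trans (le_max_left _ _)
    · obtain ⟨k, hk, h3⟩ := h2
      simp only [Set.mem_iUnion]
      exact ⟨k, hk, h3⟩
  have := hM hα
  simp only [U, Set.mem_iUnion, Set.mem_iInter] at this
  obtain ⟨g, ⟨h3, h4⟩, h5⟩ := this
  exact ⟨g, h3, h4, fun i hi => (h5 ⟨i, hi⟩).le⟩

end

section

open Polynomial

/-- The threshold for the coefficients at stage `m`, in terms of the lower bound `l`. -/
noncomputable def eta (m : ℕ) (l : ℝ) : ℝ :=
  (1 / 2) ^ uu (m + 1) / ((m + 1) * uu m * (2 * l⁻¹))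

/-- Coefficient vectors at stage `m` which are not small at low indices. -/
def Large (m s : ℕ) (l : ℝ) (α : Fin (uu (m + 1)) → ℝ) : Prop :=
  ∃ k : Fin (uu (m + 1)), k + uu m ≤ start m s ∧ eta m l ≤ |α k|

/-- `g` approximately moves the coefficient vector `α` to the start of the block of level `s`. -/
def Moves (m s : ℕ) (l : ℝ) (M : ℕ) (α : Fin (uu (m + 1)) → ℝ) (g : ℝ[X]) : Prop :=
  g.natDegree ≤ M ∧ (∀ i, |g.coeff i| ≤ M) ∧ ∀ i < uu (m + 1),
    |(X ^ uu m * g * toPoly α).coeff i - if i = start m s then 1 else 0| ≤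
      l / ((m + 1) * uu (m + 1))

/-- The constant controlling the error terms at stage `m`. -/
noncomputable def errConst (m : ℕ) (l : ℝ) (M : ℕ) : ℝ :=
  l⁻¹ * ((M + 1) * M * 2 + (uu m + M + uu (m + 1) + 1) * (uu (m + 1) * (2 * l⁻¹) * M))

/-- The smallness condition on the parameter following the stage `m`. -/
def Suit (m : ℕ) (l t : ℝ) : Prop :=
  (2 + uu (m + 1) * (2 * l⁻¹)) * t ≤ (1 / (m + 2 : ℝ)) ^ uu (m + 1) ∧
  ∃ M : ℕ, errConst m l M * t ≤ 1 / (m + 1) ∧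
    ∀ s ≤ m, ∀ α : Fin (uu (m + 1)) → ℝ, (∀ k, |α k| ≤ 2 * l⁻¹) → Large m s l α →
      ∃ g : ℝ[X], Moves m s l M α g

lemma eta_pos (m : ℕ) {l : ℝ} (hl : 0 < l) : 0 < eta m l := by
  have := uu_pos m
  unfold eta; positivity

lemma exists_suit (m : ℕ) {l : ℝ} (hl : 0 < l) {b : ℝ} (hb : 0 < b) :
    ∃ t, 0 < t ∧ t ≤ b ∧ Suit m l t := by
  have hD := uu_pos (m + 1)
  have h1 : ∀ s, ∃ M : ℕ, ∀ α : Fin (uu (m + 1)) → ℝ, (∀ k, |α k| ≤ 2 * l⁻¹) → Large m s l α →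
      ∃ g : ℝ[X], Moves m s l M α g := fun s =>
    exists_uniform_multiplier _ _ _ _ _ _ (eta_pos m hl) (by positivity)
  choose Ms hMs using h1
  set M := (Finset.range (m + 1)).sup Ms
  have hK1 : 0 < 2 + uu (m + 1) * (2 * l⁻¹) := by positivity
  have hK2 : 0 ≤ errConst m l M := by unfold errConst; positivity
  refine ⟨min b (min ((1 / (m + 2 : ℝ)) ^ uu (m + 1) / (2 + uu (m + 1) * (2 * l⁻¹)))
    (1 / (m + 1) / (errConst m l M + 1))), by positivity, min_le_left _ _, ?_, M, ?_, ?_⟩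
  · refine (mul_le_mul_of_nonneg_left ((min_le_right _ _).trans (min_le_left _ _)) hK1.le).trans
      (mul_div_cancel₀ _ hK1.ne').le
  · refine (mul_le_mul_of_nonneg_left ((min_le_right _ _).trans (min_le_right _ _)) hK2).trans ?_
    rw [mul_div_assoc', div_le_iff₀ (by positivity), mul_comm]
    exact mul_le_mul_of_nonneg_left (by linarith) (by positivity)
  · intro s hs α h2 h3
    obtain ⟨g, h4, h5, h6⟩ := hMs s α h2 h3
    have hle : Ms s ≤ M := Finset.le_sup (f := Ms) (Finset.mem_range.2 (by omega))
    exact ⟨g, h4.trans hle, fun i => (h5 i).trans (by exact_mod_cast hle), h6⟩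

/-- There is an admissible sequence decreasing sufficiently rapidly. -/
lemma exists_adm : ∃ θ : ℕ → ℝ, Adm θ ∧ ∀ m, Suit m (ell θ m) (θ (m + 1)) := by
  have key : ∀ (m : ℕ) (v : {t : ℝ // 0 < t}), ∃ w : {t : ℝ // 0 < t}, w.1 ≤ v.1 ∧
      Suit m ((v.1 ^ uu m / (m + 2)) ^ uu (m + 1)) w.1 := fun m v => by
    have hv := v.2
    obtain ⟨t, h1, h2, h3⟩ := exists_suit m
      (l := (v.1 ^ uu m / (m + 2)) ^ uu (m + 1)) (by positivity) hv
    exact ⟨⟨t, h1⟩, h2, h3⟩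
  choose nxt h1 h2 using key
  let θ' : ℕ → {t : ℝ // 0 < t} := fun n => Nat.rec ⟨1 / 4, by norm_num⟩ nxt n
  refine ⟨fun n => (θ' n).1, ⟨fun n => (θ' n).2, antitone_nat_of_succ_le fun n => h1 n (θ' n),
    le_rfl⟩, fun m => h2 m (θ' m)⟩

lemma abs_coeff_mul_toPoly_le {m M : ℕ} {B : ℝ} {g : ℝ[X]} (h2 : ∀ i, |g.coeff i| ≤ M)
    {D : ℕ} {α : Fin D → ℝ} (hB : 0 ≤ B) (hα : ∀ k, |α k| ≤ B) (i : ℕ) :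
    |(X ^ m * g * toPoly α).coeff i| ≤ D * B * M := by
  rw [coeff_mul_toPoly]
  refine (Finset.abs_sum_le_sum_abs _ _).trans
    ((Finset.sum_le_card_nsmul _ _ (B * M) fun k _ => ?_).trans ?_)
  · rw [abs_mul, mul_comm (X ^ m) g, mul_assoc, ← pow_add, coeff_mul_X_pow']
    refine mul_le_mul (hα k) ?_ (abs_nonneg _) hB
    split_ifs
    · exact h2 _
    · simp
  · simp [mul_assoc]

lemma natDegree_toPoly_lt {D : ℕ} (hD : 0 < D) (α : Fin D → ℝ) : (toPoly α).natDegree < D := by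
  rw [Nat.lt_iff_le_pred hD]
  refine natDegree_sum_le_of_forall_le _ _ fun k _ => ?_
  exact (natDegree_C_mul_X_pow_le _ _).trans (by have := k.2; simp; omega)

variable {θ : ℕ → ℝ}


/-- The coefficient vector of `x` at stage `m`. -/
noncomputable def Adm.coeffs (h : Adm θ) (m : ℕ) (x : L1) : Fin (uu (m + 1)) → ℝ :=
  fun k => h.alpha m k x

lemma Adm.abs_coeffs_le (h : Adm θ) (m : ℕ) {x : L1} (hx : ‖x‖ ≤ 1) (k : Fin (uu (m + 1))) :
    |h.coeffs m x k| ≤ 2 * (ell θ m)⁻¹ := by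
  have h0 := inv_pos.2 (h.ell_pos m)
  refine ((h.alpha m k).le_of_opNorm_le (h.norm_alpha_le m k) x).trans ?_
  exact mul_le_of_le_one_right (by positivity) hx

lemma Adm.aeval_f_zero (h : Adm θ) (p : ℝ[X]) {N : ℕ} (hN : p.natDegree < N) :
    aeval h.T p (f 0) = ∑ i ∈ Finset.range N, p.coeff i • h.e i := by
  rw [aeval_eq_sum_range' hN, sum_apply]
  rfl

lemma Adm.aeval_toPoly (h : Adm θ) (m : ℕ) (x : L1) :
    aeval h.T (toPoly (h.coeffs m x)) (f 0) = h.V m (uu (m + 1)) x := by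
  rw [h.V_apply, ← Fin.sum_univ_eq_sum_range (fun k => h.alpha m k x • h.e k)]
  rw [toPoly, map_sum, sum_apply]
  refine Finset.sum_congr rfl fun k _ => ?_
  rw [← smul_eq_C_mul, map_smul, aeval_X_pow]
  rfl

lemma Adm.norm_aeval_le (h : Adm θ) {g : ℝ[X]} {M : ℕ} (h1 : g.natDegree ≤ M)
    (h2 : ∀ i, |g.coeff i| ≤ M) :
    ‖aeval h.T g‖ ≤ (M + 1) * M := by
  rw [aeval_eq_sum_range' (Nat.lt_succ_of_le h1)]
  refine (norm_sum_le _ _).trans ((Finset.sum_le_card_nsmul _ _ (M : ℝ) fun k _ => ?_).trans ?_)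
  · rw [norm_smul]
    have := mul_le_mul (h2 k) (h.norm_pow_le k) (norm_nonneg _) (by positivity)
    simpa using this
  · simp

lemma Adm.inv_smul_e_start (h : Adm θ) {m s : ℕ} (hs : s ≤ m) :
    ((s + 1 : ℝ) * Lam θ (start m s))⁻¹ • h.e (start m s) =
      f 0 + (s + 1 : ℝ)⁻¹ • f (start m s) := by
  have hb : blk (start m s) := blk_start_add (j := 0) hs (uu_pos s)
  have h1 : off (start m s) = 0 := off_start_add (j := 0) hs (Nat.zero_le _)
  have h2 : lev (start m s) = s := lev_start_add (j := 0) hs (Nat.zero_le _)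
  have h3 := (h.Lam_pos (start m s)).ne'
  have h4 : (s + 1 : ℝ) ≠ 0 := by positivity
  rw [h.e_eq, kk_of_blk hb, h1, h2, Gam_zero, h.e_zero, smul_smul, mul_inv, mul_assoc,
    inv_mul_cancel₀ h3, mul_one, div_one, smul_add, smul_smul, inv_mul_cancel₀ h4, one_smul,
    add_comm]

/-- A vector with a large low coefficient can be moved near `f 0`. -/
lemma Adm.exists_near (h : Adm θ) {m s : ℕ} (hsuit : Suit m (ell θ m) (θ (m + 1))) (hs : s ≤ m)
    {x : L1}
    (hx : ‖x‖ ≤ 1) (hl : Large m s (ell θ m) (h.coeffs m x)) :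
    ∃ p : ℝ[X], ‖aeval h.T p x - f 0‖ ≤ 1 / (s + 1) + 2 / (m + 1) := by
  obtain ⟨-, M, hM, hsuit⟩ := hsuit
  obtain ⟨g, hg1, hg2, hg3⟩ := hsuit s hs _ (h.abs_coeffs_le m hx) hl
  set l := ell θ m
  set D := uu (m + 1)
  set d := uu m
  set R := start m s
  set t := θ (m + 1)
  set V := h.V m D
  set Q := toPoly (h.coeffs m x)
  have hl0 : 0 < l := h.ell_pos m
  have ht0 : 0 < t := h.pos _
  have hD0 : 0 < D := uu_pos _
  have hRD : R < D := start_add_lt (j := 0) hs (Nat.zero_le _)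
  set ε : ℝ := (s + 1) * Lam θ R
  have hε : l ≤ ε := by
    have := h.ell_le_Lam hRD
    have h3 := h.Lam_pos R
    have : 0 ≤ s * Lam θ R := by positivity
    simp only [ε]; linarith
  have hε0 : 0 < ε := hl0.trans_le hε
  have hεl : ε⁻¹ ≤ l⁻¹ := inv_anti₀ hl0 hε
  set q : ℝ[X] := X ^ d * g * Q
  have hq : q.natDegree < d + M + D := by
    have h1 : (X ^ d * g).natDegree ≤ d + M :=
      natDegree_mul_le.trans (add_le_add (natDegree_X_pow_le d) hg1)
    exact natDegree_mul_le.trans_lt (add_lt_add_of_le_of_lt h1 (natDegree_toPoly_lt hD0 _))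
  have hdec : aeval h.T (C ε⁻¹ * (X ^ d * g)) x =
      ε⁻¹ • (aeval h.T g ((h.T ^ d * (1 - V)) x) + aeval h.T q (f 0)) := by
    have h1 : aeval h.T q (f 0) = aeval h.T (X ^ d * g) (V x) := by
      rw [map_mul, mul_apply_eq_comp, h.aeval_toPoly]
    rw [h1, ← smul_eq_C_mul, map_smul, smul_apply, mul_comm (X ^ d) g, map_mul,
      aeval_X_pow, mul_apply_eq_comp, mul_apply_eq_comp, mul_apply_eq_comp, ← map_add, ← map_add,
      sub_apply, one_apply_eq_self, sub_add_cancel]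
  have hA : ‖aeval h.T g ((h.T ^ d * (1 - V)) x)‖ ≤ (M + 1) * M * 2 * t := by
    refine ((aeval h.T g).le_of_opNorm_le (h.norm_aeval_le hg1 hg2) _).trans ?_
    rw [mul_assoc _ (2 : ℝ)]
    refine mul_le_mul_of_nonneg_left ?_ (by positivity)
    refine ((h.T ^ d * (1 - V)).le_of_opNorm_le (h.norm_tail_le m) x).trans ?_
    exact mul_le_of_le_one_right (by positivity) hx
  have hB : ‖aeval h.T q (f 0) - h.e R‖ ≤
      l / (m + 1) + (d + M + D + 1) * (D * (2 * l⁻¹) * M) * t := by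
    have h1 : aeval h.T q (f 0) - h.e R =
        ∑ i ∈ Finset.range D, (q.coeff i - if i = R then 1 else 0) • h.e i +
          ∑ i ∈ Finset.Ico D (d + M + D), q.coeff i • h.e i := by
      rw [h.aeval_f_zero q hq, ← Finset.sum_range_add_sum_Ico _ (show D ≤ d + M + D by omega)]
      simp only [sub_smul, Finset.sum_sub_distrib, ite_smul, one_smul, zero_smul,
        Finset.sum_ite_eq', Finset.mem_range, if_pos hRD]
      abel
    rw [h1]
    refine (norm_add_le _ _).trans (add_le_add ?_ ?_)
    · refine (norm_sum_le _ _).trans ((Finset.sum_le_card_nsmul _ _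
        (l / ((m + 1) * D)) fun i hi => ?_).trans ?_)
      · rw [norm_smul]
        have := mul_le_mul (hg3 i (Finset.mem_range.1 hi)) (h.norm_e_le_one i) (norm_nonneg _)
          (by positivity)
        simpa using this
      · rw [Finset.card_range, nsmul_eq_mul]
        apply le_of_eq
        field_simp
    · refine (norm_sum_le _ _).trans ((Finset.sum_le_card_nsmul _ _
        (D * (2 * l⁻¹) * M * t) fun i hi => ?_).trans ?_)
      · rw [norm_smul]
        exact mul_le_mul (abs_coeff_mul_toPoly_le hg2 (mul_nonneg zero_le_two (inv_pos.2 hl0).le)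
          (h.abs_coeffs_le m hx) i)
          (h.norm_e_le (Finset.mem_Ico.1 hi).1) (norm_nonneg _) (by positivity)
      · rw [Nat.card_Ico, nsmul_eq_mul, Nat.add_sub_cancel, ← mul_assoc _ _ t]
        refine mul_le_mul_of_nonneg_right (mul_le_mul_of_nonneg_right ?_ (by positivity)) ht0.le
        push_cast
        have : (0 : ℝ) ≤ D := by positivity
        linarith
  refine ⟨C ε⁻¹ * (X ^ d * g), ?_⟩
  have hfin : aeval h.T (C ε⁻¹ * (X ^ d * g)) x - f 0 =
      ε⁻¹ • (aeval h.T g ((h.T ^ d * (1 - V)) x) + (aeval h.T q (f 0) - h.e R)) +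
        (s + 1 : ℝ)⁻¹ • f R := by
    have := h.inv_smul_e_start hs
    rw [hdec, ← add_sub_assoc, smul_sub, this]
    abel
  rw [hfin]
  refine (norm_add_le _ _).trans ?_
  rw [norm_smul, norm_smul, norm_f, mul_one, Real.norm_eq_abs, Real.norm_eq_abs,
    abs_of_pos (inv_pos.2 hε0), abs_of_pos (by positivity : (0 : ℝ) < (s + 1 : ℝ)⁻¹), ← one_div,
    add_comm]
  refine add_le_add (one_div _).ge ?_
  calc _ ≤ l⁻¹ * ((M + 1) * M * 2 * t +
        (l / (m + 1) + (d + M + D + 1) * (D * (2 * l⁻¹) * M) * t)) := by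
        rw [one_div]
        exact mul_le_mul hεl ((norm_add_le _ _).trans (add_le_add hA hB)) (norm_nonneg _)
          (inv_pos.2 hl0).le
    _ = errConst m l M * t + 1 / (m + 1) := by
        rw [errConst]
        simp only [← one_div]
        field_simp
        ring
    _ ≤ 2 / (m + 1) := by
        rw [show (2 : ℝ) / (m + 1) = 1 / (m + 1) + 1 / (m + 1) by ring]
        linarith

end

section

open Polynomial

variable {θ : ℕ → ℝ}


lemma Adm.alpha_of_blk (h : Adm θ) {i : ℕ} (hb : blk i) (x : L1) :
    h.alpha (stg i) i x = (Lam θ i)⁻¹ * x i := by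
  have hi := lt_uu_stg i
  have key : ∀ l, alphaCol θ (stg i) i l = if l = i then (Lam θ i)⁻¹ else 0 := fun l => by
    have h2 : ¬ ((blk l ∧ lev l ≤ stg i) ∧ off l = i) := fun ⟨⟨h3, h4⟩, h5⟩ => by
      have := h3.off_lt
      have := uu_strictMono.monotone h4
      have := hb.off_lt_self
      omega
    rw [alphaCol, if_neg h2, sub_zero]
    by_cases hl : l = i
    · rw [if_pos hl, if_pos ⟨hl ▸ hi, hl⟩, hl]
    · rw [if_neg hl, if_neg fun h' => hl h'.2]
  have h3 := hasSum_apply (h.alpha (stg i) i) x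
  simp only [h.alpha_f, key] at h3
  rw [← h3.tsum_eq, tsum_eq_single i fun l hl => by simp [hl]]
  simp [mul_comm]

lemma Adm.kk_mul_le_of_not_large (h : Adm θ) {i s : ℕ} {x : L1} (hb : blk i) (hs : s < lev i)
    (hl : ¬ Large (stg i) s (ell θ (stg i)) (h.coeffs (stg i) x)) :
    |x i| * kk θ i ≤ (1 / 2) ^ i := by
  have hi := lt_uu_stg i
  have h1 := hb.start_add_off
  have h4 := hb.lev_le
  have hα := h.alpha_of_blk hb x
  generalize stg i = m at *
  set l := ell θ m
  have hl0 : 0 < l := h.ell_pos m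
  have hle : i + uu m ≤ start m s := by
    have h2 := hb.off_lt
    have h3 := uu_strictMono.monotone h4
    have h5 : start m s = start m (lev i) + (lev i - s) * bb m := by
      rw [start, start, ← add_mul]; congr 1; omega
    have h6 : bb m ≤ (lev i - s) * bb m := Nat.le_mul_of_pos_left _ (by omega)
    have : bb m = 2 * uu m + 1 := rfl
    omega
  have h1 : |(Lam θ i)⁻¹ * x i| < eta m l := by
    by_contra hn
    refine hl ⟨⟨i, hi⟩, hle, ?_⟩
    rw [Adm.coeffs, hα]
    exact not_lt.1 hn
  have hLam := h.Lam_pos i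
  rw [abs_mul, abs_of_pos (inv_pos.2 hLam)] at h1
  have h2 : |x i| ≤ eta m l := by
    refine le_trans ?_ h1.le
    exact le_mul_of_one_le_left (abs_nonneg _) (one_le_inv₀ hLam |>.2 (h.Lam_le_one i))
  have h3 : kk θ i ≤ l⁻¹ := h.kk_le h4
  have hu : (1 : ℝ) ≤ uu m := by exact_mod_cast uu_pos m
  calc |x i| * kk θ i ≤ eta m l * l⁻¹ := mul_le_mul h2 h3 (h.kk_nonneg i) (eta_pos m hl0).le
    _ = (1 / 2) ^ uu (m + 1) / (2 * ((m + 1) * uu m)) := by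
      rw [eta]; field_simp
    _ ≤ (1 / 2) ^ uu (m + 1) := by
      refine div_le_self (by positivity) ?_
      nlinarith
    _ ≤ (1 / 2) ^ i := pow_le_pow_of_le_one (by norm_num) (by norm_num) hi.le

lemma Adm.norm_V_le_of_not_large (h : Adm θ) {m s : ℕ} {x : L1} (hs : s ≤ m)
    (hl : ¬ Large m s (ell θ m) (h.coeffs m x)) : ‖h.V m (uu m) x‖ ≤ 1 / (m + 1) := by
  have hl0 := h.ell_pos m
  have hl1 := (one_le_inv₀ hl0).2 (h.ell_le_one m)
  have hu := uu_pos m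
  rw [h.V_apply]
  refine (norm_sum_le _ _).trans ((Finset.sum_le_card_nsmul _ _ (eta m (ell θ m))
    fun k hk => ?_).trans ?_)
  · rw [Finset.mem_range] at hk
    have h1 : |h.alpha m k x| < eta m (ell θ m) := by
      by_contra hn
      refine hl ⟨⟨k, hk.trans (uu_lt_succ m)⟩, ?_, not_lt.1 hn⟩
      have := bb_le_start hs
      have : bb m = 2 * uu m + 1 := rfl
      simp only
      omega
    rw [norm_smul]
    exact (mul_le_of_le_one_right (norm_nonneg _) (h.norm_e_le_one k)).trans h1.le
  · rw [Finset.card_range, nsmul_eq_mul, eta]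
    have h2 : ((1 : ℝ) / 2) ^ uu (m + 1) ≤ 1 := pow_le_one₀ (by norm_num) (by norm_num)
    rw [mul_div_assoc', div_le_div_iff₀ (by positivity) (by positivity)]
    have h3 : (0 : ℝ) < (m + 1) * uu m := by positivity
    nlinarith

lemma Adm.exists_large (h : Adm θ) {x : L1} (hx : x ≠ 0) (s n₀ : ℕ) :
    ∃ m, n₀ ≤ m ∧ s ≤ m ∧ Large m s (ell θ m) (h.coeffs m x) := by
  by_contra hcon
  push Not at hcon
  set n₁ := max n₀ s
  have hcon' : ∀ m, n₁ ≤ m → ¬ Large m s (ell θ m) (h.coeffs m x) := fun m hm =>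
    hcon m ((le_max_left _ _).trans hm) ((le_max_right _ _).trans hm)
  have hsumk : Summable fun i => |x i| * kk θ i := by
    have hg : Summable fun i => |x i| * (ell θ s)⁻¹ + (1 / 2 : ℝ) ^ i :=
      ((hasSum_norm x).summable.mul_right _).add
        (summable_geometric_of_lt_one (by norm_num) (by norm_num))
    refine Summable.of_norm_bounded_eventually_nat hg ?_
    filter_upwards [eventually_ge_atTop (uu n₁)] with i hi
    have h0 : 0 ≤ |x i| * (ell θ s)⁻¹ := mul_nonneg (abs_nonneg _) (inv_pos.2 (h.ell_pos s)).le
    rw [Real.norm_eq_abs, abs_of_nonneg (mul_nonneg (abs_nonneg _) (h.kk_nonneg i))]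
    by_cases hlev : lev i ≤ s
    · have := mul_le_mul_of_nonneg_left (h.kk_le hlev) (abs_nonneg (x i))
      have : (0 : ℝ) ≤ (1 / 2) ^ i := by positivity
      linarith
    · refine le_trans ?_ (le_add_of_nonneg_left h0)
      by_cases hb : blk i
      · exact h.kk_mul_le_of_not_large hb (not_le.1 hlev) (hcon' _ (le_stg hi))
      · rw [kk_of_not_blk hb, mul_zero]; positivity
  have hsum : Summable fun i => |x i| * (1 + kk θ i) := by
    simp only [mul_add, mul_one]
    exact (hasSum_norm x).summable.add hsumk
  have hbound : ∀ m, n₁ ≤ m →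
      ‖x‖ ≤ 1 / (m + 1) + ∑' i, |x (i + uu m)| * (1 + kk θ (i + uu m)) := by
    intro m hm
    have h1 := h.norm_V_le_of_not_large ((le_max_right _ _).trans hm) (hcon' m hm)
    set g : ℕ → ℝ := fun i => if i < uu m then 0 else 1 + kk θ i
    have hgle : ∀ i, |x i| * g i ≤ |x i| * (1 + kk θ i) := fun i => by
      refine mul_le_mul_of_nonneg_left ?_ (abs_nonneg _)
      simp only [g]; split_ifs
      · have := h.kk_nonneg i
        positivity
      · exact le_rfl
    have hgnn : ∀ i, 0 ≤ g i := fun i => by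
      have := h.kk_nonneg i
      simp only [g]; split_ifs <;> positivity
    have hgsum : Summable fun i => |x i| * g i :=
      hsum.of_nonneg_of_le (fun i => mul_nonneg (abs_nonneg _) (hgnn i)) hgle
    have h2 := norm_apply_le (1 - h.V m (uu m)) x hgsum fun i => by
      rw [sub_apply, one_apply_eq_self]
      by_cases hi : i < uu m
      · rw [h.V_f_of_lt le_rfl (uu_lt_succ m).le hi, sub_self, norm_zero]
        exact hgnn i
      · simp only [g, if_neg hi]
        refine (norm_sub_le _ _).trans ?_
        rw [norm_f]
        exact add_le_add_right (h.norm_V_f_le le_rfl (uu_lt_succ m).le (not_lt.1 hi)) _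
    rw [← hgsum.sum_add_tsum_nat_add (uu m), Finset.sum_eq_zero fun i hi => by
      simp [g, Finset.mem_range.1 hi], zero_add, sub_apply, one_apply_eq_self] at h2
    have h3 : ‖x‖ ≤ ‖h.V m (uu m) x‖ + ‖x - h.V m (uu m) x‖ := by
      simpa using norm_add_le (h.V m (uu m) x) (x - h.V m (uu m) x)
    simpa [g] using h3.trans (add_le_add h1 h2)
  have hlim : Tendsto (fun m : ℕ => (1 : ℝ) / (m + 1) +
      ∑' i, |x (i + uu m)| * (1 + kk θ (i + uu m))) atTop (𝓝 (0 + 0)) :=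
    tendsto_one_div_add_atTop_nhds_zero_nat.add
      ((tendsto_sum_nat_add fun i => |x i| * (1 + kk θ i)).comp uu_strictMono.tendsto_atTop)
  have := ge_of_tendsto hlim (eventually_atTop.2 ⟨n₁, hbound⟩)
  rw [add_zero] at this
  exact hx (norm_le_zero_iff.1 this)

/-- The operator has no nontrivial closed invariant subspace. -/
lemma Adm.eq_top_of_invariant (h : Adm θ) (hsuit : ∀ m, Suit m (ell θ m) (θ (m + 1)))
    {J : Submodule ℝ L1}
    (hc : IsClosed (J : Set L1)) (hJ : J ≠ ⊥) (hT : ∀ x ∈ J, h.T x ∈ J) : J = ⊤ := by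
  obtain ⟨x₀, hx₀, hne⟩ := J.ne_bot_iff.1 hJ
  set x := ‖x₀‖⁻¹ • x₀
  have hxJ : x ∈ J := J.smul_mem _ hx₀
  have hxn : ‖x‖ = 1 := norm_smul_inv_norm (𝕜 := ℝ) hne
  have hx0 : x ≠ 0 := by rw [← norm_ne_zero_iff, hxn]; exact one_ne_zero
  have hpow : ∀ (t : ℕ), ∀ y ∈ J, (h.T ^ t) y ∈ J := by
    intro t
    induction t with
    | zero => exact fun y hy => hy
    | succ t ih => exact fun y hy => by rw [pow_succ]; exact ih _ (hT y hy)
  have hpoly : ∀ p : ℝ[X], aeval h.T p x ∈ J := fun p => by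
    rw [aeval_eq_sum_range, sum_apply]
    exact J.sum_mem fun i _ => J.smul_mem _ (hpow i x hxJ)
  have h0 : f 0 ∈ J := by
    rw [← SetLike.mem_coe, ← hc.closure_eq, Metric.mem_closure_iff]
    intro ε hε
    obtain ⟨s, hs⟩ := exists_nat_one_div_lt (half_pos hε)
    obtain ⟨n₀, hn₀⟩ := exists_nat_one_div_lt (half_pos (half_pos hε))
    obtain ⟨m, hm, hsm, hl⟩ := h.exists_large hx0 s n₀
    obtain ⟨p, hp⟩ := h.exists_near (hsuit m) hsm hxn.le hl
    refine ⟨_, hpoly p, ?_⟩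
    rw [dist_comm, dist_eq_norm]
    refine hp.trans_lt ?_
    have h1 : (1 : ℝ) / (m + 1) ≤ 1 / (n₀ + 1) := by gcongr
    rw [show (2 : ℝ) / (m + 1) = 2 * (1 / (m + 1)) by ring]
    linarith
  have he : ∀ i, h.e i ∈ J := fun i => hpow i _ h0
  refine eq_top_of_f_mem hc fun i => ?_
  rw [h.f_eq]
  exact J.sub_mem (J.smul_mem _ (he i)) (J.smul_mem _ (he _))

end

section

/-- The coordinate functionals on `ℓ¹`. -/
noncomputable def coord (k : ℕ) : L1 →L[ℝ] ℝ :=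
  LinearMap.mkContinuous
    { toFun := fun x => x k
      map_add' := fun _ _ => rfl
      map_smul' := fun _ _ => rfl } 1 fun x => by
    rw [one_mul]; exact lp.norm_apply_le_norm one_ne_zero x k

lemma coord_apply (k : ℕ) (x : L1) : coord k x = x k := rfl

lemma hasSum_apply_apply (Z : L1 →L[ℝ] L1) (x : L1) (k : ℕ) :
    HasSum (fun i => x i * Z (f i) k) (Z x k) := by
  have := hasSum_apply ((coord k).comp Z) x
  simpa [coord_apply] using this

lemma norm_le_of_abs_le {x y : L1} (h : ∀ i, |x i| ≤ |y i|) : ‖x‖ ≤ ‖y‖ :=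
  hasSum_le h (hasSum_norm x) (hasSum_norm y)

/-- A solid closed subspace invariant under a matrix with nonzero subdiagonal and infinitely many
nonzero entries in the row `0` is trivial. -/
lemma eq_bot_or_eq_top_of_solid {N : L1 →L[ℝ] L1} (h1 : ∀ i, N (f i) (i + 1) ≠ 0)
    (h2 : ∀ j, ∃ i, j ≤ i ∧ N (f i) 0 ≠ 0) {J : Submodule ℝ L1} (hc : IsClosed (J : Set L1))
    (hs : ∀ x ∈ J, ∀ y : L1, (∀ i, |y i| ≤ |x i|) → y ∈ J) (hN : ∀ x ∈ J, N x ∈ J) :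
    J = ⊥ ∨ J = ⊤ := by
  refine or_iff_not_imp_left.2 fun hJ => ?_
  have hmem : ∀ x ∈ J, ∀ j, x j ≠ 0 → f j ∈ J := fun x hx j hj => by
    have h3 : x j • f j ∈ J := hs x hx _ fun i => by
      rw [lp.coeFn_smul, Pi.smul_apply, f_apply]
      split_ifs with hij
      · simp [hij]
      · simp
    have h4 := J.smul_mem (x j)⁻¹ h3
    rwa [smul_smul, inv_mul_cancel₀ hj, one_smul] at h4
  have hstep : ∀ i j, f i ∈ J → f (i + j) ∈ J := fun i j hi => by
    induction j with
    | zero => exact hi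
    | succ j ih => exact hmem _ (hN _ ih) _ (h1 _)
  obtain ⟨x, hx, hne⟩ := J.ne_bot_iff.1 hJ
  obtain ⟨j, hj⟩ : ∃ j, x j ≠ 0 := by
    by_contra hcon
    push Not at hcon
    exact hne (lp.ext (funext hcon))
  have hfj := hmem x hx j hj
  obtain ⟨i, hi, hi0⟩ := h2 j
  obtain ⟨t, rfl⟩ := Nat.exists_eq_add_of_le hi
  have h0 := hmem _ (hN _ (hstep j t hfj)) 0 hi0
  refine eq_top_of_f_mem hc fun i => ?_
  simpa using hstep 0 i h0

/-- The elementary nilpotent operator sending `f 1` to `f 0`. -/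
noncomputable def elem : L1 →L[ℝ] L1 := (coord 1).smulRight (f 0)

lemma elem_f (i : ℕ) : elem (f i) = if i = 1 then f 0 else 0 := by
  simp only [elem, ContinuousLinearMap.smulRight_apply, coord_apply, f_apply]
  by_cases h : i = 1
  · simp [h]
  · rw [if_neg (Ne.symm h), if_neg h, zero_smul]

lemma elem_mul_elem : elem * elem = 0 := clm_ext fun i => by
  rw [mul_apply_eq_comp, elem_f]
  split_ifs <;> simp [elem_f]

/-- The shear adding a multiple of the coordinate `1` to the coordinate `0`. -/
noncomputable def shear (c : ℝ) : L1 →L[ℝ] L1 := 1 + c • elem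

lemma shear_mul (c d : ℝ) : shear c * shear d = shear (c + d) := by
  simp only [shear, add_mul, mul_add, one_mul, mul_one, smul_mul_smul_comm, elem_mul_elem,
    smul_zero, add_smul]
  abel

lemma shear_zero : shear 0 = 1 := by simp [shear]

lemma shear_f (c : ℝ) (i : ℕ) : shear c (f i) = f i + if i = 1 then c • f 0 else 0 := by
  rw [shear, add_apply, smul_apply, one_apply_eq_self, elem_f]
  split_ifs <;> simp

/-- The perturbation parameter normalizing the spectral radius of the positive part to `1`. -/
noncomputable def shift (θ : ℕ → ℝ) : ℝ := (1 - ∑' i, Lam θ i * mu θ i) / lam θ 0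

/-- The entries of the row `0` of the positive part. -/
noncomputable def row (θ : ℕ → ℝ) (i : ℕ) : ℝ := mu θ i + if i = 0 then lam θ 0 * shift θ else 0

/-- The columns of the negative part of `h.A`. -/
noncomputable def negCol (θ : ℕ → ℝ) (i : ℕ) : L1 :=
  if i = 1 then (shift θ * lam θ 0) • f 1 + (shift θ * (shift θ * lam θ 0)) • f 0
  else nu θ i • f (off i + 1) + (if off i + 1 = 1 then nu θ i * shift θ else 0) • f 0

lemma shear_mul_shear_neg (c : ℝ) : shear c * shear (-c) = 1 := by
  rw [shear_mul, add_neg_cancel, shear_zero]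

lemma shear_neg_mul_shear (c : ℝ) : shear (-c) * shear c = 1 := by
  rw [shear_mul, neg_add_cancel, shear_zero]

lemma hasSum_geom :
    HasSum (fun i : ℕ => (1 / 4 : ℝ) ^ i * (1 / 4)) ((1 - 1 / 4)⁻¹ * (1 / 4)) :=
  (hasSum_geometric_of_lt_one (by norm_num) (by norm_num)).mul_right _

lemma mu_zero (θ : ℕ → ℝ) : mu θ 0 = 0 := mu_of_not_before fun h => not_blk_one h.1

lemma mu_one (θ : ℕ → ℝ) : mu θ 1 = 0 := mu_of_not_before fun h => not_blk_two h.1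

lemma col_zero (θ : ℕ → ℝ) : col θ 0 = lam θ 0 • f 1 := by
  rw [col, mu_zero, nu_of_not_final fun h => not_blk_zero h.1]; simp

lemma col_one (θ : ℕ → ℝ) : col θ 1 = lam θ 1 • f 2 := by
  rw [col, mu_one, nu_of_not_final fun h => not_blk_one h.1]; simp

lemma smul_f_apply_nonneg {a : ℝ} (ha : 0 ≤ a) (i k : ℕ) : 0 ≤ (a • f i : L1) k := by
  rw [lp.coeFn_smul, Pi.smul_apply, f_apply]
  split_ifs <;> simp [ha]

lemma negCol_zero (θ : ℕ → ℝ) : negCol θ 0 = 0 := by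
  simp [negCol, nu_of_not_final fun h' => not_blk_zero h'.1]

variable {θ : ℕ → ℝ}


/-- The final operator, similar to `h.T`. -/
noncomputable def Adm.A (h : Adm θ) : L1 →L[ℝ] L1 := shear (shift θ) * h.T * shear (-shift θ)

lemma Adm.A_pow (h : Adm θ) (n : ℕ) : h.A ^ n = shear (shift θ) * h.T ^ n * shear (-shift θ) := by
  induction n with
  | zero => rw [pow_zero, pow_zero, mul_one, shear_mul_shear_neg]
  | succ n ih =>
    rw [pow_succ, ih, Adm.A, pow_succ]
    calc _ = shear (shift θ) * h.T ^ n * (shear (-shift θ) * shear (shift θ)) * h.T *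
          shear (-shift θ) := by simp only [mul_assoc]
      _ = _ := by rw [shear_neg_mul_shear, mul_one, ← mul_assoc]

lemma Adm.tendsto_A (h : Adm θ) (hsuit : ∀ m, Suit m (ell θ m) (θ (m + 1))) :
    Tendsto (fun n : ℕ => ‖h.A ^ n‖ ^ (1 / (n : ℝ))) atTop (𝓝 0) := by
  refine tendsto_root_zero (fun n => norm_nonneg _) fun δ hδ =>
    ⟨‖shear (shift θ)‖ * ‖shear (-shift θ)‖, ?_⟩
  filter_upwards [h.norm_pow_le_geom (fun m => (hsuit m).1) hδ] with n hn
  rw [h.A_pow]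
  calc _ ≤ ‖shear (shift θ)‖ * ‖h.T ^ n‖ * ‖shear (-shift θ)‖ :=
        (norm_mul_le _ _).trans (mul_le_mul_of_nonneg_right (norm_mul_le _ _) (norm_nonneg _))
    _ ≤ ‖shear (shift θ)‖ * δ ^ n * ‖shear (-shift θ)‖ := by gcongr
    _ = _ := by ring

lemma Adm.not_exists_invariant (h : Adm θ) (hsuit : ∀ m, Suit m (ell θ m) (θ (m + 1))) :
    ¬ ∃ J : Submodule ℝ L1, IsClosed (J : Set L1) ∧ J ≠ ⊥ ∧ J ≠ ⊤ ∧ ∀ x ∈ J, h.A x ∈ J := by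
  rintro ⟨J, hc, hbot, htop, hA⟩
  have h1 : ∀ y : L1, shear (shift θ) (shear (-shift θ) y) = y := fun y => by
    rw [← mul_apply_eq_comp, shear_mul_shear_neg, one_apply_eq_self]
  have h2 : ∀ y : L1, shear (-shift θ) (shear (shift θ) y) = y := fun y => by
    rw [← mul_apply_eq_comp, shear_neg_mul_shear, one_apply_eq_self]
  have key := h.eq_top_of_invariant hsuit (J := J.comap (shear (shift θ)).toLinearMap)
    (hc.preimage (shear (shift θ)).continuous) ?_ ?_
  · refine htop (eq_top_iff.2 fun y _ => ?_)
    have : shear (-shift θ) y ∈ J.comap (shear (shift θ)).toLinearMap := key ▸ Submodule.mem_top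
    rw [Submodule.mem_comap] at this
    rw [← h1 y]; exact this
  · obtain ⟨y, hy, hne⟩ := J.ne_bot_iff.1 hbot
    refine (Submodule.ne_bot_iff _).2 ⟨shear (-shift θ) y, ?_, fun h0 => hne ?_⟩
    · rw [Submodule.mem_comap]
      change shear (shift θ) (shear (-shift θ) y) ∈ J
      rwa [h1]
    · rw [← h1 y, h0, map_zero]
  · intro x hx
    rw [Submodule.mem_comap] at hx ⊢
    have := hA _ hx
    rw [Adm.A, mul_apply_eq_comp, mul_apply_eq_comp] at this
    change shear (shift θ) (h.T (shear (-shift θ) (shear (shift θ) x))) ∈ J at this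
    rwa [h2] at this

lemma Adm.mu_le (h : Adm θ) (i : ℕ) : mu θ i ≤ 1 / 4 := by
  by_cases hb : before i
  · have h1 := h.lam_add_mu_le hb.not_blk
    have := h.lam_pos i
    have := h.le_quarter (stg (i + 1))
    linarith
  · rw [mu_of_not_before hb]; norm_num

lemma Adm.mu_pos (h : Adm θ) {i : ℕ} (hi : before i) : 0 < mu θ i := by
  rw [mu_of_before hi, kk_of_blk hi.1]
  exact mul_pos (h.lam_pos i) (div_pos (by positivity) (h.Gam_pos _))

lemma Adm.summable_Lam (h : Adm θ) : Summable (Lam θ) :=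
  (summable_geometric_of_lt_one (by norm_num) (by norm_num)).of_nonneg_of_le
    (fun i => (h.Lam_pos i).le) h.Lam_le

lemma Adm.Lam_mul_mu_le (h : Adm θ) (i : ℕ) : Lam θ i * mu θ i ≤ (1 / 4) ^ i * (1 / 4) :=
  mul_le_mul (h.Lam_le i) (h.mu_le i) (h.mu_nonneg i) (by positivity)

lemma Adm.Lam_mul_mu_nonneg (h : Adm θ) (i : ℕ) : 0 ≤ Lam θ i * mu θ i :=
  mul_nonneg (h.Lam_pos i).le (h.mu_nonneg i)

lemma Adm.summable_Lam_mul_mu (h : Adm θ) : Summable fun i => Lam θ i * mu θ i :=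
  hasSum_geom.summable.of_nonneg_of_le h.Lam_mul_mu_nonneg h.Lam_mul_mu_le

lemma Adm.lam_mul_shift (h : Adm θ) : lam θ 0 * shift θ = 1 - ∑' i, Lam θ i * mu θ i :=
  mul_div_cancel₀ _ (h.lam_pos 0).ne'

lemma Adm.lam_mul_shift_le (h : Adm θ) : lam θ 0 * shift θ ≤ 1 := by
  have : 0 ≤ ∑' i, Lam θ i * mu θ i := tsum_nonneg h.Lam_mul_mu_nonneg
  rw [h.lam_mul_shift]; linarith

lemma Adm.shift_nonneg (h : Adm θ) : 0 ≤ shift θ := by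
  have := hasSum_le h.Lam_mul_mu_le h.summable_Lam_mul_mu.hasSum hasSum_geom
  refine div_nonneg ?_ (h.lam_pos 0).le
  norm_num at this ⊢
  linarith

lemma Adm.row_nonneg (h : Adm θ) (i : ℕ) : 0 ≤ row θ i := by
  refine add_nonneg (h.mu_nonneg i) ?_
  split_ifs
  exacts [mul_nonneg (h.lam_pos 0).le h.shift_nonneg, le_rfl]

lemma Adm.mu_le_row (h : Adm θ) (i : ℕ) : mu θ i ≤ row θ i := by
  refine le_add_of_nonneg_right ?_
  split_ifs
  exacts [mul_nonneg (h.lam_pos 0).le h.shift_nonneg, le_rfl]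

lemma Adm.row_le (h : Adm θ) (i : ℕ) : row θ i ≤ 1 := by
  rw [row]
  split_ifs with hi
  · rw [hi, mu_zero, zero_add]; exact h.lam_mul_shift_le
  · have := h.mu_le i
    linarith

/-- The positive part of `h.A`. -/
noncomputable def Adm.P (h : Adm θ) : L1 →L[ℝ] L1 :=
  ofCols (fun i => lam θ i • f (i + 1) + row θ i • f 0) 2 fun i => by
    refine (norm_add_le _ _).trans ?_
    rw [norm_smul, norm_smul, norm_f, norm_f, mul_one, mul_one, Real.norm_eq_abs,
      Real.norm_eq_abs, abs_of_pos (h.lam_pos i), abs_of_nonneg (h.row_nonneg i)]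
    linarith [h.row_le i, h.lam_le_one i]

lemma Adm.P_f (h : Adm θ) (i : ℕ) : h.P (f i) = lam θ i • f (i + 1) + row θ i • f 0 :=
  ofCols_f _ _ _ i

lemma Adm.A_f (h : Adm θ) (i : ℕ) : h.A (f i) = h.P (f i) - negCol θ i := by
  rw [Adm.A, mul_apply_eq_comp, mul_apply_eq_comp, shear_f, h.P_f, negCol, row]
  by_cases h1 : i = 1
  · subst h1
    simp only [if_true, map_add, map_smul, h.T_f, col_zero, col_one, shear_f, mu_one, one_ne_zero,
      if_false, OfNat.ofNat_ne_one, smul_add, smul_smul]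
    module
  · rw [if_neg h1, if_neg h1, add_zero, h.T_f, col]
    rcases eq_or_ne i 0 with rfl | h0
    · simp only [map_sub, map_add, map_smul, shear_f, mu_zero,
        nu_of_not_final fun h' => not_blk_zero h'.1, zero_add, if_true]
      simp only [zero_smul, ite_self, zero_mul]
      module
    · rw [if_neg h0]
      simp only [map_sub, map_add, map_smul, shear_f]
      rw [if_neg (by omega), if_neg zero_ne_one]
      split_ifs <;> module

lemma Adm.P_nonneg (h : Adm θ) (i k : ℕ) : 0 ≤ h.P (f i) k := by
  rw [h.P_f]
  exact add_nonneg (smul_f_apply_nonneg (h.lam_pos i).le _ _)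
    (smul_f_apply_nonneg (h.row_nonneg i) _ _)

lemma Adm.negCol_nonneg (h : Adm θ) (i k : ℕ) : 0 ≤ negCol θ i k := by
  have hs := h.shift_nonneg
  have hl := (h.lam_pos 0).le
  have hn := h.nu_nonneg i
  rw [negCol]
  split_ifs <;>
  refine add_nonneg (smul_f_apply_nonneg ?_ _ _) (smul_f_apply_nonneg ?_ _ _) <;>
  positivity

lemma Adm.disjoint (h : Adm θ) (i k : ℕ) : h.P (f i) k * negCol θ i k = 0 := by
  rw [h.P_f, negCol]
  by_cases h1 : i = 1
  · subst h1
    rw [if_pos rfl, row, mu_one]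
    simp only [lp.coeFn_add, lp.coeFn_smul, Pi.add_apply, Pi.smul_apply, f_apply, smul_eq_mul]
    rcases k with _ | _ | k <;> simp
  · rw [if_neg h1]
    by_cases hf : final i
    · have h0 : i ≠ 0 := fun h0 => not_blk_zero (h0 ▸ hf.1)
      have hlt := hf.1.off_lt_self
      rw [row, mu_of_not_before hf.not_before, if_neg h0]
      simp only [lp.coeFn_add, lp.coeFn_smul, Pi.add_apply, Pi.smul_apply, f_apply, smul_eq_mul]
      by_cases hk : k = i + 1
      · rw [if_neg (show k ≠ off i + 1 by omega), if_neg (show k ≠ 0 by omega)]; simp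
      · simp [hk]
    · rw [nu_of_not_final hf]; simp

lemma Adm.apply_eq (h : Adm θ) (i k : ℕ) : h.A (f i) k = h.P (f i) k - negCol θ i k := by
  rw [h.A_f]; rfl

lemma Adm.max_eq (h : Adm θ) (i k : ℕ) : h.P (f i) k = max (h.A (f i) k) 0 := by
  have h1 := h.P_nonneg i k
  have h2 := h.negCol_nonneg i k
  rw [h.apply_eq]
  rcases mul_eq_zero.1 (h.disjoint i k) with h3 | h3 <;> rw [h3] <;> simp [h1, h2]

lemma Adm.P_sub_A (h : Adm θ) (i : ℕ) : (h.P - h.A) (f i) = negCol θ i := by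
  rw [sub_apply, h.A_f]; abel

/-- The eigenvector of the positive part. -/
noncomputable def Adm.eig (h : Adm θ) : L1 := ⟨Lam θ, memℓp_gen (by
  simpa using h.summable_Lam.norm)⟩

lemma Adm.eig_apply (h : Adm θ) (i : ℕ) : h.eig i = Lam θ i := rfl

lemma Adm.P_eig (h : Adm θ) : h.P h.eig = h.eig := by
  have h1 := hasSum_apply h.P h.eig
  have h2 : HasSum (fun i => Lam θ (i + 1) • f (i + 1)) (h.eig - Lam θ 0 • f 0) := by
    have := (hasSum_nat_add_iff' 1).2 (hasSum_f h.eig)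
    simpa [h.eig_apply] using this
  have h3 : HasSum (fun i => Lam θ i * row θ i) 1 := by
    have h4 := h.summable_Lam_mul_mu.hasSum.add (hasSum_ite_eq 0 (lam θ 0 * shift θ))
    rw [h.lam_mul_shift, add_sub_cancel] at h4
    convert h4 using 2 with i
    rw [row, mul_add, h.lam_mul_shift]
    split_ifs with hi
    · rw [hi, Lam_zero, one_mul, one_mul]
    · rw [mul_zero]
  have h5 := h2.add (h3.smul_const (f 0))
  rw [Lam_zero, one_smul, sub_add_cancel] at h5
  refine h1.unique ?_
  convert h5 using 2 with i
  rw [h.eig_apply, h.P_f, Lam_succ, smul_add, smul_smul, smul_smul]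

lemma Adm.one_le_norm_eig (h : Adm θ) : 1 ≤ ‖h.eig‖ := by
  have := lp.norm_apply_le_norm one_ne_zero h.eig 0
  rwa [h.eig_apply, Lam_zero, norm_one] at this

lemma Adm.eig_ne_zero (h : Adm θ) : h.eig ≠ 0 :=
  norm_ne_zero_iff.1 (one_pos.trans_le h.one_le_norm_eig).ne'

lemma Adm.P_mono (h : Adm θ) {x y : L1} (hxy : ∀ i, x i ≤ y i) (k : ℕ) : h.P x k ≤ h.P y k :=
  hasSum_le (fun i => mul_le_mul_of_nonneg_right (hxy i) (h.P_nonneg i k))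
    (hasSum_apply_apply h.P x k) (hasSum_apply_apply h.P y k)

lemma Adm.P_pow_eig (h : Adm θ) (n : ℕ) : (h.P ^ n) h.eig = h.eig := by
  induction n with
  | zero => rfl
  | succ n ih => rw [pow_succ, mul_apply_eq_comp, h.P_eig, ih]

lemma Adm.norm_P_pow_f_zero_le (h : Adm θ) (n : ℕ) : ‖(h.P ^ n) (f 0)‖ ≤ ‖h.eig‖ := by
  have key : ∀ k, 0 ≤ (h.P ^ n) (f 0) k ∧ (h.P ^ n) (f 0) k ≤ h.eig k := by
    induction n with
    | zero =>
      intro k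
      rw [pow_zero, one_apply_eq_self, f_apply, h.eig_apply]
      split_ifs with hk
      · rw [hk, Lam_zero]; simp
      · exact ⟨le_rfl, (h.Lam_pos k).le⟩
    | succ n ih =>
      intro k
      rw [pow_succ', mul_apply_eq_comp]
      constructor
      · have := h.P_mono (x := 0) (fun i => (ih i).1) k
        rwa [map_zero] at this
      · have := h.P_mono (fun i => (ih i).2) k
        rwa [h.P_eig] at this
  refine norm_le_of_abs_le fun k => ?_
  rw [abs_of_nonneg (key k).1]
  exact (key k).2.trans (le_abs_self _)

lemma Adm.norm_P_pow_le (h : Adm θ) (n : ℕ) : ‖h.P ^ n‖ ≤ 2 * ‖h.eig‖ := by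
  refine opNorm_le _ ?_
  have h1 := h.one_le_norm_eig
  induction n with
  | zero =>
    intro i
    rw [pow_zero, one_apply_eq_self, norm_f]
    linarith
  | succ n ih =>
    intro i
    rw [pow_succ, mul_apply_eq_comp, h.P_f, map_add, map_smul, map_smul]
    refine (norm_add_le _ _).trans ?_
    rw [norm_smul, norm_smul, Real.norm_eq_abs, Real.norm_eq_abs, abs_of_pos (h.lam_pos i),
      abs_of_nonneg (h.row_nonneg i)]
    have h2 := mul_le_mul (h.lam_le i) (ih (i + 1)) (norm_nonneg _) (by norm_num)
    have h3 := mul_le_mul (h.row_le i) (h.norm_P_pow_f_zero_le n) (norm_nonneg _) zero_le_one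
    linarith

lemma Adm.one_le_norm_P_pow (h : Adm θ) (n : ℕ) : 1 ≤ ‖h.P ^ n‖ := by
  have h1 := (h.P ^ n).le_opNorm h.eig
  rw [h.P_pow_eig] at h1
  exact le_of_mul_le_mul_right (by rwa [one_mul]) (norm_pos_iff.2 h.eig_ne_zero)

lemma Adm.tendsto_P (h : Adm θ) : Tendsto (fun n : ℕ => ‖h.P ^ n‖ ^ (1 / (n : ℝ))) atTop (𝓝 1) :=
  tendsto_root_one h.one_le_norm_P_pow h.norm_P_pow_le

lemma Adm.P_f_succ_pos (h : Adm θ) (i : ℕ) : 0 < h.P (f i) (i + 1) := by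
  rw [h.P_f, lp.coeFn_add, Pi.add_apply, lp.coeFn_smul, Pi.smul_apply, f_apply, if_pos rfl,
    smul_eq_mul, mul_one]
  exact add_pos_of_pos_of_nonneg (h.lam_pos i) (smul_f_apply_nonneg (h.row_nonneg i) _ _)

lemma Adm.exists_P_f_zero_pos (h : Adm θ) (j : ℕ) : ∃ i, j ≤ i ∧ 0 < h.P (f i) 0 := by
  have hb := before_start (Nat.zero_le j)
  refine ⟨start j 0 - 1, ?_, ?_⟩
  · have := bb_le_start (Nat.zero_le j)
    have := lt_uu j
    have : bb j = 2 * uu j + 1 := rfl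
    omega
  · rw [h.P_f, lp.coeFn_add, Pi.add_apply, lp.coeFn_smul (row θ _), Pi.smul_apply, f_apply 0,
      if_pos rfl, smul_eq_mul, mul_one]
    exact add_pos_of_nonneg_of_pos (smul_f_apply_nonneg (h.lam_pos _).le _ _)
      ((h.mu_pos hb).trans_le (h.mu_le_row _))

lemma Adm.eq_bot_or_eq_top (h : Adm θ) {N : L1 →L[ℝ] L1} (hN : ∀ i k, h.P (f i) k ≤ N (f i) k)
    (J : Submodule ℝ L1) (hc : IsClosed (J : Set L1))
    (hs : ∀ x ∈ J, ∀ y : L1, (∀ i, |y i| ≤ |x i|) → y ∈ J) (hJ : ∀ x ∈ J, N x ∈ J) :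
    J = ⊥ ∨ J = ⊤ :=
  eq_bot_or_eq_top_of_solid (fun i => ((h.P_f_succ_pos i).trans_le (hN _ _)).ne')
    (fun j => let ⟨i, hi, hp⟩ := h.exists_P_f_zero_pos j; ⟨i, hi, (hp.trans_le (hN _ _)).ne'⟩)
    hc hs hJ

lemma Adm.modulus_apply (h : Adm θ) (i k : ℕ) : (h.P + (h.P - h.A)) (f i) k = |h.A (f i) k| := by
  have h1 := h.P_nonneg i k
  have h2 := h.negCol_nonneg i k
  rw [add_apply, h.P_sub_A, lp.coeFn_add, Pi.add_apply, h.apply_eq]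
  rcases mul_eq_zero.1 (h.disjoint i k) with h3 | h3 <;> rw [h3] <;>
    simp [abs_of_nonneg, h1, h2]

lemma Adm.max_neg_eq (h : Adm θ) (i k : ℕ) : (h.P - h.A) (f i) k = max (-(h.A (f i) k)) 0 := by
  have h1 := h.P_nonneg i k
  have h2 := h.negCol_nonneg i k
  rw [h.P_sub_A, h.apply_eq]
  rcases mul_eq_zero.1 (h.disjoint i k) with h3 | h3 <;> rw [h3] <;> simp [h1, h2]

end

end ReadOperator

/-- There exists a quasinilpotent bounded operator `T` on `ℓ¹` with no nontrivial
closed invariant subspace such that: the positive part `T⁺` has strictly positive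
spectral radius which is an eigenvalue with a positive eigenvector; the negative part
`T⁻` has a nonzero positive eigenvector (indeed `T⁻ f₀ = 0`); and neither the modulus
`|T|` nor `T⁺` has a nontrivial closed invariant ideal (C. J. Read's operator). -/
theorem exists_read_operator_full_properties :
    ∃ T M Tpos Tneg : lp (fun _ : ℕ => ℝ) 1 →L[ℝ] lp (fun _ : ℕ => ℝ) 1,
      -- matrix entries of the modulus, positive part and negative part
      (∀ i j : ℕ, M (lp.single 1 j 1) i = |T (lp.single 1 j 1) i|) ∧
      (∀ i j : ℕ, Tpos (lp.single 1 j 1) i = max (T (lp.single 1 j 1) i) 0) ∧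
      (∀ i j : ℕ, Tneg (lp.single 1 j 1) i = max (-(T (lp.single 1 j 1) i)) 0) ∧
      -- (1) `T` is quasinilpotent
      Tendsto (fun n : ℕ => ‖T ^ n‖ ^ (1 / (n : ℝ))) atTop (nhds 0) ∧
      -- (2) `T` has no nontrivial closed invariant subspace
      (¬ ∃ J : Submodule ℝ (lp (fun _ : ℕ => ℝ) 1),
        IsClosed (J : Set (lp (fun _ : ℕ => ℝ) 1)) ∧ J ≠ ⊥ ∧ J ≠ ⊤ ∧
        ∀ x ∈ J, T x ∈ J) ∧
      -- (3) `r(T⁺) > 0` is an eigenvalue of `T⁺` with a positive eigenvector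
      (∃ r : ℝ, Tendsto (fun n : ℕ => ‖Tpos ^ n‖ ^ (1 / (n : ℝ))) atTop (nhds r) ∧
        0 < r ∧
        ∃ x : lp (fun _ : ℕ => ℝ) 1, (∀ i, 0 ≤ x i) ∧ x ≠ 0 ∧ Tpos x = r • x) ∧
      -- (4) `T⁻` has a nonzero positive eigenvector; indeed `T⁻ f₀ = 0`
      (∃ x : lp (fun _ : ℕ => ℝ) 1, (∀ i, 0 ≤ x i) ∧ x ≠ 0 ∧
        ∃ μ : ℝ, Tneg x = μ • x) ∧
      Tneg (lp.single 1 0 1) = 0 ∧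
      -- (5) neither `|T|` nor `T⁺` has a nontrivial closed invariant ideal
      (∀ J : Submodule ℝ (lp (fun _ : ℕ => ℝ) 1),
        IsClosed (J : Set (lp (fun _ : ℕ => ℝ) 1)) →
        (∀ x ∈ J, ∀ y : lp (fun _ : ℕ => ℝ) 1, (∀ i, |y i| ≤ |x i|) → y ∈ J) →
        (∀ x ∈ J, M x ∈ J) → J = ⊥ ∨ J = ⊤) ∧
      (∀ J : Submodule ℝ (lp (fun _ : ℕ => ℝ) 1),
        IsClosed (J : Set (lp (fun _ : ℕ => ℝ) 1)) →
        (∀ x ∈ J, ∀ y : lp (fun _ : ℕ => ℝ) 1, (∀ i, |y i| ≤ |x i|) → y ∈ J) →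
        (∀ x ∈ J, Tpos x ∈ J) → J = ⊥ ∨ J = ⊤) := by
  obtain ⟨θ, h, hsuit⟩ := ReadOperator.exists_adm
  have h0 : (h.P - h.A) (ReadOperator.f 0) = 0 := by rw [h.P_sub_A, ReadOperator.negCol_zero]
  refine ⟨h.A, h.P + (h.P - h.A), h.P, h.P - h.A, fun i j => h.modulus_apply j i,
    fun i j => h.max_eq j i, fun i j => h.max_neg_eq j i, h.tendsto_A hsuit,
    h.not_exists_invariant hsuit,
    ⟨1, h.tendsto_P, one_pos, h.eig, fun i => (h.Lam_pos i).le, h.eig_ne_zero, ?_⟩,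
    ⟨ReadOperator.f 0, fun i => ?_, ReadOperator.f_ne_zero 0, 0, ?_⟩, h0,
    h.eq_bot_or_eq_top fun i k => ?_, h.eq_bot_or_eq_top fun i k => le_rfl⟩
  · rw [h.P_eig, one_smul]
  · rw [ReadOperator.f_apply]; split_ifs <;> norm_num
  · rw [h0, zero_smul]
  · rw [h.modulus_apply, h.max_eq]
    exact max_le (le_abs_self _) (abs_nonneg _)
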